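/- arXiv:1812.04649 — 2 statements merged into one kernel-verified Lean document; each statement's English description precedes it below -/
import Mathlib

section
/- Let k ≥ 1 and let D₁, …, D_k be pairwise disjoint Jordan regions in the unit sphere S² ⊆ ℝ³. Let Q = S² \ ⋃ᵢ int(Dᵢ), where int denotes interior in the subspace topology of S² (so Q is a compact surface of genus zero whose boundary circles are the frontiers ∂D₁, …, ∂D_k). Fix points pᵢ ∈ ∂Dᵢ for i = 1, …, k, and let T be a countable subset of Q \ ⋃ᵢ ∂Dᵢ. Then there exists a topological embedding h : E_k → Q such that h(qᵢ) = pᵢ for each i, the image h(E_k) is disjoint from T, and h(E_k) intersects ⋃ᵢ ∂Dᵢ precisely in the set {p₁, …, p_k}. -/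
open Metric Set

/-- The point `(x, y)` of the Euclidean plane. -/
noncomputable def pt2 (x y : ℝ) : EuclideanSpace ℝ (Fin 2) :=
  (WithLp.equiv 2 (Fin 2 → ℝ)).symm ![x, y]

/-- The `j`-th endpoint `q_j = (cos (2πj/k), sin (2πj/k))` of the standard `k`-pointed star. -/
noncomputable def starVertex (k j : ℕ) : EuclideanSpace ℝ (Fin 2) :=
  pt2 (Real.cos (2 * Real.pi * j / k)) (Real.sin (2 * Real.pi * j / k))

/-- The standard `k`-pointed star `E_k ⊆ ℝ²`: the union of the closed segments from the
origin to the points `q_j`, `j = 1, …, k`. -/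
noncomputable def starSet (k : ℕ) : Set (EuclideanSpace ℝ (Fin 2)) :=
  ⋃ j ∈ Finset.Icc 1 k, segment ℝ 0 (starVertex k j)

/-- The unit sphere `S² ⊆ ℝ³`, as a topological (metric) space. -/
abbrev Sphere2 : Type := ↥(Metric.sphere (0 : EuclideanSpace ℝ (Fin 3)) 1)

/-- A Jordan region in `S²`: the image of a topological embedding of the closed unit disc
of `ℝ²` which carries the unit circle onto the frontier of the image. -/
def IsJordanRegion (D : Set Sphere2) : Prop :=
  ∃ f : EuclideanSpace ℝ (Fin 2) → Sphere2,
    Topology.IsEmbedding ((Metric.closedBall (0 : EuclideanSpace ℝ (Fin 2)) 1).restrict f) ∧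
    f '' Metric.closedBall (0 : EuclideanSpace ℝ (Fin 2)) 1 = D ∧
    f '' Metric.sphere (0 : EuclideanSpace ℝ (Fin 2)) 1 = frontier D


/-! ### Continuous logarithms -/

/-- The function `φ` has a continuous logarithm on the set `K`. -/
def HasLogOn {X : Type*} [TopologicalSpace X] (φ : X → ℂ) (K : Set X) : Prop :=
  ∃ g : X → ℂ, ContinuousOn g K ∧ ∀ z ∈ K, Complex.exp (g z) = φ z

/-- Every continuous nowhere vanishing function on `K` has a continuous logarithm on `K`. -/
def LogTrivial {X : Type*} [TopologicalSpace X] (K : Set X) : Prop :=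
  ∀ φ : X → ℂ, ContinuousOn φ K → (∀ z ∈ K, φ z ≠ 0) → HasLogOn φ K

section Logarithms

variable {X : Type*} [TopologicalSpace X]

theorem IsPreconnected.eq_of_exp_eq_one {S : Set X} (hS : IsPreconnected S) {g : X → ℂ}
    (hg : ContinuousOn g S) (h1 : ∀ x ∈ S, Complex.exp (g x) = 1) {x y : X}
    (hx : x ∈ S) (hy : y ∈ S) : g x = g y := by
  have key : ∀ x ∈ S, ∃ n : ℤ, g x = n * (2 * Real.pi * Complex.I) := fun x hx =>
    Complex.exp_eq_one_iff.1 (h1 x hx)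
  choose! n hn using key
  have hpi : (2 * Real.pi * Complex.I : ℂ) ≠ 0 := Complex.two_pi_I_ne_zero
  set u : X → ℝ := fun x => (g x / (2 * Real.pi * Complex.I)).re with hu
  have hun : ∀ x ∈ S, u x = n x := by
    intro x hx
    simp only [hu]
    rw [hn x hx, mul_div_assoc, div_self hpi]
    simp
  have huc : ContinuousOn u S :=
    Complex.continuous_re.comp_continuousOn (hg.div_const _)
  have hle : ∀ x ∈ S, ∀ y ∈ S, n y ≤ n x := by
    intro x hx y hy
    by_contra hlt
    push Not at hlt
    have hlt' : (n x : ℝ) + 1 ≤ n y := by exact_mod_cast hlt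
    obtain ⟨z, hz, hzu⟩ := hS.intermediate_value hx hy huc
      (show (n x : ℝ) + 1 / 2 ∈ Icc (u x) (u y) by
        rw [hun x hx, hun y hy]; constructor <;> linarith)
    rw [hun z hz] at hzu
    have h2 : ((2 * n z - 2 * n x : ℤ) : ℝ) = (1 : ℤ) := by push_cast; linarith
    have h3 : 2 * n z - 2 * n x = 1 := by exact_mod_cast h2
    omega
  rw [hn x hx, hn y hy, le_antisymm (hle y hy x hx) (hle x hx y hy)]

theorem HasLogOn.mono {φ : X → ℂ} {K L : Set X} (h : HasLogOn φ K) (hLK : L ⊆ K) :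
    HasLogOn φ L :=
  let ⟨g, hg, hge⟩ := h
  ⟨g, hg.mono hLK, fun z hz => hge z (hLK hz)⟩

theorem HasLogOn.mul {φ ψ : X → ℂ} {K : Set X} (hφ : HasLogOn φ K) (hψ : HasLogOn ψ K) :
    HasLogOn (fun z => φ z * ψ z) K := by
  obtain ⟨g, hg, hge⟩ := hφ
  obtain ⟨f, hf, hfe⟩ := hψ
  exact ⟨fun z => g z + f z, hg.add hf, fun z hz => by rw [Complex.exp_add, hge z hz, hfe z hz]⟩

theorem HasLogOn.inv {φ : X → ℂ} {K : Set X} (hφ : HasLogOn φ K) :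
    HasLogOn (fun z => (φ z)⁻¹) K := by
  obtain ⟨g, hg, hge⟩ := hφ
  exact ⟨fun z => - g z, hg.neg, fun z hz => by rw [Complex.exp_neg, hge z hz]⟩

theorem HasLogOn.congr {φ ψ : X → ℂ} {K : Set X} (hφ : HasLogOn φ K)
    (h : ∀ z ∈ K, φ z = ψ z) : HasLogOn ψ K := by
  obtain ⟨g, hg, hge⟩ := hφ
  exact ⟨g, hg, fun z hz => by rw [hge z hz, h z hz]⟩

theorem HasLogOn.of_slitPlane {φ : X → ℂ} {K : Set X} (hφ : ContinuousOn φ K)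
    (h : ∀ z ∈ K, φ z ∈ Complex.slitPlane) : HasLogOn φ K :=
  ⟨fun z => Complex.log (φ z), hφ.clog h,
    fun z hz => Complex.exp_log (Complex.slitPlane_ne_zero (h z hz))⟩

theorem HasLogOn.union {φ : X → ℂ} {A B : Set X} (hA : IsClosed A) (hB : IsClosed B)
    (hAB : IsPreconnected (A ∩ B)) (h1 : HasLogOn φ A) (h2 : HasLogOn φ B) :
    HasLogOn φ (A ∪ B) := by
  classical
  obtain ⟨f, hf, hfe⟩ := h1
  obtain ⟨g, hg, hge⟩ := h2
  obtain ⟨c, hc1, hc⟩ : ∃ c : ℂ, Complex.exp c = 1 ∧ ∀ z ∈ A ∩ B, f z = g z + c := by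
    rcases (A ∩ B).eq_empty_or_nonempty with he | ⟨w, hw⟩
    · exact ⟨0, Complex.exp_zero, by simp [he]⟩
    have h1 : ∀ z ∈ A ∩ B, Complex.exp (f z - g z) = 1 := by
      intro z hz
      rw [Complex.exp_sub, hfe z hz.1, hge z hz.2, div_self]
      rw [← hfe z hz.1]
      exact Complex.exp_ne_zero _
    refine ⟨f w - g w, h1 w hw, fun z hz => ?_⟩
    have := hAB.eq_of_exp_eq_one ((hf.mono inter_subset_left).sub (hg.mono inter_subset_right))
      h1 hz hw
    simp only [Pi.sub_apply] at this
    linear_combination this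
  let F : X → ℂ := fun z => if z ∈ A then f z else g z + c
  have hFA : EqOn F f A := fun z hz => if_pos hz
  have hFB : EqOn F (fun z => g z + c) B := by
    intro z hz
    by_cases hzA : z ∈ A
    · rw [hFA hzA]
      exact hc z ⟨hzA, hz⟩
    · exact if_neg hzA
  refine ⟨F, ContinuousOn.union_of_isClosed (hf.congr hFA)
    ((hg.add continuousOn_const).congr hFB) hA hB, ?_⟩
  rintro z (hz | hz)
  · rw [hFA hz, hfe z hz]
  · rw [hFB hz]
    simp only
    rw [Complex.exp_add, hc1, mul_one, hge z hz]

theorem LogTrivial.union {A B : Set X} (hA : IsClosed A) (hB : IsClosed B)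
    (hAB : IsPreconnected (A ∩ B)) (h1 : LogTrivial A) (h2 : LogTrivial B) :
    LogTrivial (A ∪ B) := fun φ hφ h0 =>
  HasLogOn.union hA hB hAB
    (h1 φ (hφ.mono subset_union_left) fun z hz => h0 z (Or.inl hz))
    (h2 φ (hφ.mono subset_union_right) fun z hz => h0 z (Or.inr hz))

theorem logTrivial_empty : LogTrivial (∅ : Set X) := fun _ _ _ =>
  ⟨0, continuousOn_empty _, by simp⟩

theorem LogTrivial.biUnion {ι : Type*} (S : Finset ι) (D : ι → Set X)
    (hD : ∀ i ∈ S, IsClosed (D i)) (hL : ∀ i ∈ S, LogTrivial (D i))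
    (hdisj : ∀ i ∈ S, ∀ j ∈ S, i ≠ j → Disjoint (D i) (D j)) :
    LogTrivial (⋃ i ∈ S, D i) := by
  classical
  induction S using Finset.induction_on with
  | empty => simpa using logTrivial_empty
  | insert a S ha ih =>
    rw [Finset.set_biUnion_insert]
    refine LogTrivial.union (hD a (by simp)) ?_ ?_ (hL a (by simp)) ?_
    · exact S.finite_toSet.isClosed_biUnion fun i hi => hD i (Finset.mem_insert_of_mem hi)
    · rw [Disjoint.inter_eq]
      · exact isPreconnected_empty
      · rw [disjoint_iUnion₂_right]
        intro i hi
        exact hdisj a (by simp) i (Finset.mem_insert_of_mem hi) (by rintro rfl; exact ha hi)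
    · exact ih (fun i hi => hD i (Finset.mem_insert_of_mem hi))
        (fun i hi => hL i (Finset.mem_insert_of_mem hi))
        (fun i hi j hj => hdisj i (Finset.mem_insert_of_mem hi) j (Finset.mem_insert_of_mem hj))

theorem LogTrivial.image {Y : Type*} [TopologicalSpace Y] [T2Space Y] {C : Set X}
    (hC : IsCompact C) (hL : LogTrivial C) {f : X → Y} (hf : ContinuousOn f C)
    (hinj : InjOn f C) : LogTrivial (f '' C) := by
  rcases C.eq_empty_or_nonempty with he | ⟨x₀, hx₀⟩
  · simpa [he] using logTrivial_empty
  have : Nonempty X := ⟨x₀⟩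
  intro φ hφ h0
  obtain ⟨g, hg, hge⟩ := hL (fun x => φ (f x)) (hφ.comp hf (mapsTo_image f C))
    fun z hz => h0 _ (mem_image_of_mem f hz)
  have hinv : ∀ z ∈ C, Function.invFunOn f C (f z) = z := fun z hz =>
    hinj.leftInvOn_invFunOn hz
  refine ⟨fun y => g (Function.invFunOn f C y), ?_, ?_⟩
  · refine hg.comp ?_ ?_
    · have hcl : ∀ t : Set X, IsClosed t → IsClosed (f '' (C ∩ t)) := fun t ht =>
        ((hC.inter_right ht).image_of_continuousOn (hf.mono inter_subset_left)).isClosed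
      rw [continuousOn_iff_isClosed]
      intro t ht
      refine ⟨f '' (C ∩ t), hcl t ht, ?_⟩
      ext y
      constructor
      · rintro ⟨hy, z, hz, rfl⟩
        refine ⟨⟨z, ⟨hz, ?_⟩, rfl⟩, mem_image_of_mem f hz⟩
        simpa [hinv z hz] using hy
      · rintro ⟨⟨z, ⟨hz, hzt⟩, rfl⟩, hy⟩
        refine ⟨?_, hy⟩
        simpa [hinv z hz] using hzt
    · rintro _ ⟨z, hz, rfl⟩
      rwa [hinv z hz]
  · rintro _ ⟨z, hz, rfl⟩
    simp only [hinv z hz]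
    exact hge z hz

end Logarithms

theorem Convex.logTrivial {E : Type*} [NormedAddCommGroup E] [NormedSpace ℝ E] {C : Set E}
    (hC : IsCompact C) (hconv : Convex ℝ C) : LogTrivial C := by
  rcases C.eq_empty_or_nonempty with he | ⟨x₀, hx₀⟩
  · simpa [he] using logTrivial_empty
  intro φ hφ h0
  obtain ⟨w, hw, hwmin⟩ := hC.exists_isMinOn ⟨x₀, hx₀⟩ hφ.norm
  have hm : 0 < ‖φ w‖ := norm_pos_iff.2 (h0 w hw)
  have huc := hC.uniformContinuousOn_of_continuous hφ
  obtain ⟨δ, hδ, hδφ⟩ := Metric.uniformContinuousOn_iff.1 huc ‖φ w‖ hm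
  obtain ⟨R, hR⟩ := hC.isBounded.subset_closedBall x₀
  obtain ⟨N, hN⟩ := exists_nat_gt (max 0 (R / δ))
  have hN0 : (0 : ℝ) < N := (le_max_left _ _).trans_lt hN
  have hRN : R / N < δ := by
    rw [div_lt_iff₀ hN0]
    have := (le_max_right 0 (R / δ)).trans_lt hN
    rw [div_lt_iff₀ hδ] at this
    linarith
  let p : ℕ → E → E := fun j x => x₀ + ((j : ℝ) / N) • (x - x₀)
  have hpC : ∀ j ≤ N, ∀ x ∈ C, p j x ∈ C := by
    intro j hj x hx
    refine hconv.add_smul_sub_mem hx₀ hx ⟨by positivity, ?_⟩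
    rw [div_le_one hN0]
    exact_mod_cast hj
  have hpc : ∀ j, Continuous (p j) := fun j => by fun_prop
  have hdist : ∀ j, ∀ x ∈ C, dist (p (j + 1) x) (p j x) < δ := by
    intro j x hx
    have : p (j + 1) x - p j x = (1 / (N : ℝ)) • (x - x₀) := by
      simp only [p]
      rw [add_sub_add_left_eq_sub, ← sub_smul]
      congr 1
      push_cast
      ring
    rw [dist_eq_norm, this, norm_smul, Real.norm_of_nonneg (by positivity)]
    have h1 : ‖x - x₀‖ ≤ R := by simpa [dist_eq_norm] using hR hx
    calc 1 / (N : ℝ) * ‖x - x₀‖ ≤ 1 / (N : ℝ) * R := by gcongr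
      _ = R / N := by ring
      _ < δ := hRN
  have hφp : ∀ j ≤ N, ContinuousOn (fun x => φ (p j x)) C := fun j hj =>
    hφ.comp (hpc j).continuousOn (hpC j hj)
  have hslit : ∀ j ∈ Finset.range N, ∀ x ∈ C, φ (p (j + 1) x) / φ (p j x) ∈ Complex.slitPlane := by
    intro j hj x hx
    rw [Finset.mem_range] at hj
    have ha := hpC (j + 1) hj x hx
    have hb := hpC j hj.le x hx
    have h1 : ‖φ (p (j + 1) x) / φ (p j x) - 1‖ < 1 := by
      rw [div_sub_one (h0 _ hb), norm_div, div_lt_one (norm_pos_iff.2 (h0 _ hb)), ← dist_eq_norm]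
      exact (hδφ _ ha _ hb (hdist j x hx)).trans_le (hwmin hb)
    have := Complex.mem_slitPlane_of_norm_lt_one h1
    simpa using this
  refine ⟨fun x => Complex.log (φ x₀) +
    ∑ j ∈ Finset.range N, Complex.log (φ (p (j + 1) x) / φ (p j x)), ?_, ?_⟩
  · refine continuousOn_const.add (continuousOn_finsetSum _ fun j hj => ?_)
    have hj' := Finset.mem_range.1 hj
    exact ((hφp (j + 1) hj').div (hφp j hj'.le) fun x hx => h0 _ (hpC j hj'.le x hx)).clog
      (hslit j hj)
  · intro x hx
    have h2 : ∀ n ≤ N, ∏ j ∈ Finset.range n, φ (p (j + 1) x) / φ (p j x)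
        = φ (p n x) / φ (p 0 x) := by
      intro n hn
      induction n with
      | zero => simp [div_self (h0 _ (hpC 0 hn x hx))]
      | succ n ih =>
        rw [Finset.prod_range_succ, ih (by omega), mul_comm, div_mul_div_cancel₀]
        exact h0 _ (hpC n (by omega) x hx)
    rw [Complex.exp_add, Complex.exp_sum, Complex.exp_log (h0 x₀ hx₀)]
    rw [Finset.prod_congr rfl fun j hj =>
      Complex.exp_log (Complex.slitPlane_ne_zero (hslit j hj x hx)), h2 N le_rfl]
    have e0 : p 0 x = x₀ := by simp [p]
    have eN : p N x = x := by simp [p, div_self hN0.ne']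
    rw [e0, eN, mul_div_cancel₀ _ (h0 x₀ hx₀)]

/-! ### Separation of the plane by closed sets -/

theorem not_hasLogOn_sphere (a : ℂ) {R : ℝ} (hR : 0 < R) :
    ¬ HasLogOn (fun z => z - a) (sphere a R) := by
  rintro ⟨g, hg, hge⟩
  have hmem : ∀ θ : ℝ, circleMap a R θ ∈ sphere a R := fun θ => circleMap_mem_sphere a hR.le θ
  have hc : Continuous fun θ : ℝ => g (circleMap a R θ) - θ * Complex.I - Real.log R := by
    have : Continuous fun θ : ℝ => g (circleMap a R θ) := by
      rw [← continuousOn_univ]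
      exact hg.comp (continuous_circleMap a R).continuousOn fun θ _ => hmem θ
    exact (this.sub (by fun_prop)).sub continuous_const
  have h1 : ∀ θ ∈ (univ : Set ℝ),
      Complex.exp (g (circleMap a R θ) - θ * Complex.I - Real.log R) = 1 := by
    intro θ _
    have hR' : (R : ℂ) ≠ 0 := by exact_mod_cast hR.ne'
    rw [Complex.exp_sub, Complex.exp_sub, hge _ (hmem θ), ← Complex.ofReal_exp, Real.exp_log hR]
    simp only [circleMap, add_sub_cancel_left]
    have := Complex.exp_ne_zero (θ * Complex.I)
    field_simp
  have h2 := isPreconnected_univ.eq_of_exp_eq_one hc.continuousOn h1 (mem_univ 0)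
    (mem_univ (2 * Real.pi))
  have h3 : circleMap a R (2 * Real.pi) = circleMap a R 0 := by
    simpa using (periodic_circleMap a R) 0
  rw [h3] at h2
  have h4 : (2 * Real.pi * Complex.I : ℂ) = 0 := by
    push_cast at h2
    linear_combination h2
  exact Complex.two_pi_I_ne_zero h4

theorem IsPreconnected.hasLogOn_div {K S : Set ℂ} (hK : IsClosed K) (hS : IsPreconnected S)
    (hSK : Disjoint S K) {a b : ℂ} (ha : a ∈ S) (hb : b ∈ S) :
    HasLogOn (fun z => (z - a) / (z - b)) K := by
  have hne : ∀ x ∈ S, ∀ z ∈ K, z - x ≠ 0 := by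
    intro x hx z hz h
    rw [sub_eq_zero] at h
    exact hSK.le_bot ⟨hx, h ▸ hz⟩
  refine hS.induction₂' (fun x y => HasLogOn (fun z => (z - x) / (z - y)) K) ?_ ?_ ha hb
  · intro x hx
    obtain ⟨r, hr, hrK⟩ := Metric.isOpen_iff.1 hK.isOpen_compl x (hSK.le_compl_right hx)
    have : ∀ᶠ y in nhdsWithin x S, y ∈ S ∧ dist y x < r :=
      (eventually_mem_nhdsWithin).and
        (eventually_nhdsWithin_of_eventually_nhds (Metric.ball_mem_nhds x hr))
    filter_upwards [this] with y hy
    have h1 : HasLogOn (fun z => (z - y) / (z - x)) K := by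
      refine HasLogOn.of_slitPlane ?_ fun z hz => ?_
      · exact ContinuousOn.div (by fun_prop) (by fun_prop) (hne x hx)
      · have hzx := hne x hx z hz
        have hlt : ‖(x - y) / (z - x)‖ < 1 := by
          rw [norm_div, div_lt_one (norm_pos_iff.2 hzx), ← dist_eq_norm, ← dist_eq_norm, dist_comm]
          refine hy.2.trans_le ?_
          by_contra hlt
          exact hrK (Metric.mem_ball.2 (not_le.1 hlt)) hz
        have h2 := Complex.mem_slitPlane_of_norm_lt_one hlt
        have h3 : 1 + (x - y) / (z - x) = (z - y) / (z - x) := by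
          field_simp
          ring
        rwa [h3] at h2
    exact ⟨h1.inv.congr fun z _ => inv_div _ _, h1⟩
  · intro x y z hx hy hz hxy hyz
    exact (hxy.mul hyz).congr fun w hw => div_mul_div_cancel₀ (hne y hy w hw)

theorem frontier_connectedComponentIn_subset {K : Set ℂ} (hK : IsClosed K) (a : ℂ) :
    frontier (connectedComponentIn Kᶜ a) ⊆ K := by
  have hUo : IsOpen (connectedComponentIn Kᶜ a) := hK.isOpen_compl.connectedComponentIn
  intro z hz
  by_contra hzK
  rw [hUo.frontier_eq] at hz
  have hVo : IsOpen (connectedComponentIn Kᶜ z) := hK.isOpen_compl.connectedComponentIn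
  obtain ⟨w, hw1, hw2⟩ := mem_closure_iff.1 hz.1 _ hVo (mem_connectedComponentIn hzK)
  apply hz.2
  rw [connectedComponentIn_eq hw2, ← connectedComponentIn_eq hw1]
  exact mem_connectedComponentIn hzK

theorem HasLogOn.mem_connectedComponentIn {K : Set ℂ} (hK : IsClosed K)
    (hb : Bornology.IsBounded Kᶜ) {a b : ℂ} (haK : a ∉ K) (hbK : b ∉ K)
    (h : HasLogOn (fun z => (z - a) / (z - b)) K) : b ∈ connectedComponentIn Kᶜ a := by
  classical
  by_contra hbU
  set U := connectedComponentIn Kᶜ a with hU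
  have hUo : IsOpen U := hK.isOpen_compl.connectedComponentIn
  have haU : a ∈ U := _root_.mem_connectedComponentIn haK
  have hfr : frontier U ⊆ K := frontier_connectedComponentIn_subset hK a
  have hUb : Bornology.IsBounded U := hb.subset (connectedComponentIn_subset _ _)
  have hbcl : b ∉ closure U := fun hcl => hbK (hfr (by rw [hUo.frontier_eq]; exact ⟨hcl, hbU⟩))
  obtain ⟨g, hg, hge⟩ := h
  obtain ⟨G, hG⟩ := ContinuousMap.exists_restrict_eq hK
    (⟨K.domRestrict g, continuousOn_iff_continuous_domRestrict.1 hg⟩ : C(K, ℂ))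
  have hGg : ∀ z ∈ K, G z = g z := fun z hz => by
    have := DFunLike.congr_fun hG ⟨z, hz⟩
    simpa using this
  let F : ℂ → ℂ := fun z => if z ∈ closure U then (z - b) * Complex.exp (G z) else z - a
  have hFc : Continuous F := by
    refine Continuous.if ?_ (by fun_prop) (by fun_prop)
    intro z hz
    have hzU : z ∈ frontier U := frontier_closure_subset hz
    have hzK := hfr hzU
    have hzb : z - b ≠ 0 := by
      intro h0
      rw [sub_eq_zero] at h0
      exact hbK (h0 ▸ hzK)
    rw [hGg z hzK, hge z hzK, mul_div_cancel₀ _ hzb]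
  have hF0 : ∀ z, F z ≠ 0 := by
    intro z
    by_cases hz : z ∈ closure U
    · simp only [F, if_pos hz]
      refine mul_ne_zero (fun h0 => ?_) (Complex.exp_ne_zero _)
      rw [sub_eq_zero] at h0
      exact hbcl (h0 ▸ hz)
    · simp only [F, if_neg hz]
      intro h0
      rw [sub_eq_zero] at h0
      exact hz (h0 ▸ subset_closure haU)
  obtain ⟨R, hR0, hR⟩ := hUb.closure.subset_ball_lt 0 a
  have hlog : HasLogOn F (closedBall a R) :=
    (convex_closedBall a R).logTrivial (isCompact_closedBall a R) F hFc.continuousOn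
      fun z _ => hF0 z
  refine not_hasLogOn_sphere a hR0 ((hlog.mono sphere_subset_closedBall).congr fun z hz => ?_)
  have : z ∉ closure U := fun hzU => by
    have h1 := hR hzU
    rw [mem_ball] at h1
    rw [mem_sphere] at hz
    linarith
  simp only [F, if_neg this]

theorem LogTrivial.isPreconnected_compl {K : Set ℂ} (hK : IsCompact K) (hL : LogTrivial K) :
    IsPreconnected Kᶜ := by
  refine isPreconnected_of_forall_pair fun a ha b hb => ?_
  obtain ⟨R, hR0, hR⟩ := ((hK.isBounded.union
    (Set.toFinite {a, b}).isBounded)).subset_ball_lt 0 (0 : ℂ)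
  have hKR : K ⊆ ball 0 R := subset_union_left.trans hR
  have haR : a ∈ ball 0 R := hR (Or.inr (by simp))
  have hbR : b ∈ ball 0 R := hR (Or.inr (by simp))
  have hBcl : IsClosed (ball (0 : ℂ) R)ᶜ := isOpen_ball.isClosed_compl
  have hmem : b ∈ connectedComponentIn (K ∪ (ball 0 R)ᶜ)ᶜ a := by
    refine HasLogOn.mem_connectedComponentIn (hK.isClosed.union hBcl) ?_ ?_ ?_ ?_
    · refine (isBounded_ball (x := (0 : ℂ)) (r := R)).subset ?_
      rw [compl_union, compl_compl]
      exact inter_subset_right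
    · rintro (h | h)
      exacts [ha h, h haR]
    · rintro (h | h)
      exacts [hb h, h hbR]
    · refine HasLogOn.union hK.isClosed hBcl ?_ (hL _ ?_ ?_) ?_
      · rw [(disjoint_compl_right_iff_subset.2 hKR).inter_eq]
        exact isPreconnected_empty
      · refine ContinuousOn.div (by fun_prop) (by fun_prop) fun z hz h0 => ?_
        rw [sub_eq_zero] at h0
        exact hb (h0 ▸ hz)
      · intro z hz
        refine div_ne_zero (fun h0 => ?_) (fun h0 => ?_) <;> rw [sub_eq_zero] at h0
        exacts [ha (h0 ▸ hz), hb (h0 ▸ hz)]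
      · exact (convex_ball (0 : ℂ) R).isPreconnected.hasLogOn_div hBcl disjoint_compl_right haR hbR
  refine ⟨connectedComponentIn (K ∪ (ball 0 R)ᶜ)ᶜ a, ?_, ?_, hmem,
    isPreconnected_connectedComponentIn⟩
  · exact (connectedComponentIn_subset _ _).trans (compl_subset_compl.2 subset_union_left)
  · refine _root_.mem_connectedComponentIn ?_
    rintro (h | h)
    exacts [ha h, h haR]

/-- Points of `Kᶜ` near `p` can be joined by small connected subsets of `Kᶜ`. -/
def UniformlyAccessible (K : Set ℂ) (p : ℂ) : Prop :=
  ∀ ε > 0, ∃ δ > 0, ∀ a ∈ ball p δ \ K, ∀ b ∈ ball p δ \ K,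
    b ∈ connectedComponentIn (ball p ε \ K) a

theorem UniformlyAccessible.union {K F : Set ℂ} {p : ℂ} (h : UniformlyAccessible K p)
    (hF : IsClosed F) (hp : p ∉ F) : UniformlyAccessible (K ∪ F) p := by
  obtain ⟨r, hr, hrF⟩ := Metric.isOpen_iff.1 hF.isOpen_compl p hp
  intro ε hε
  obtain ⟨δ, hδ, H⟩ := h (min ε r) (lt_min hε hr)
  refine ⟨δ, hδ, fun a ha b hb => ?_⟩
  refine connectedComponentIn_mono a ?_ (H a ⟨ha.1, fun h => ha.2 (Or.inl h)⟩ b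
    ⟨hb.1, fun h => hb.2 (Or.inl h)⟩)
  rintro z ⟨hz, hzK⟩
  refine ⟨ball_subset_ball (min_le_left _ _) hz, ?_⟩
  rintro (h | h)
  exacts [hzK h, hrF (ball_subset_ball (min_le_right _ _) hz) h]

theorem LogTrivial.uniformlyAccessible {D : Set ℂ} (hD : IsClosed D) (hL : LogTrivial D) {p : ℂ}
    (hp : ∀ ε > 0, ∃ D' ⊆ D, IsClosed D' ∧ IsPreconnected D' ∧ p ∉ D' ∧ D \ ball p ε ⊆ D') :
    UniformlyAccessible D p := by
  intro ε hε
  obtain ⟨D', hD'D, hD'cl, hD'c, hpD', hsub⟩ := hp ε hε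
  have hBcl : IsClosed (D' ∪ (ball p ε)ᶜ) := hD'cl.union isOpen_ball.isClosed_compl
  have hpB : p ∉ D' ∪ (ball p ε)ᶜ := by
    rintro (h | h)
    exacts [hpD' h, h (mem_ball_self hε)]
  obtain ⟨δ, hδ, hδB⟩ := Metric.isOpen_iff.1 hBcl.isOpen_compl p hpB
  refine ⟨δ, hδ, fun a ha b hb => ?_⟩
  have hin : ∀ x ∈ ball p δ, x ∈ ball p ε := fun x hx => by
    by_contra h
    exact hδB hx (Or.inr h)
  have heq : ball p ε \ D = (D ∪ (D' ∪ (ball p ε)ᶜ))ᶜ := by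
    ext z
    simp only [mem_sdiff, mem_compl_iff, mem_union, not_or, not_not]
    exact ⟨fun h => ⟨h.2, fun h' => h.2 (hD'D h'), h.1⟩, fun h => ⟨h.2.2, h.1⟩⟩
  rw [heq]
  have haB : a ∉ D ∪ (D' ∪ (ball p ε)ᶜ) := by
    have : a ∈ ball p ε \ D := ⟨hin a ha.1, ha.2⟩
    rwa [heq] at this
  have hbB : b ∉ D ∪ (D' ∪ (ball p ε)ᶜ) := by
    have : b ∈ ball p ε \ D := ⟨hin b hb.1, hb.2⟩
    rwa [heq] at this
  refine HasLogOn.mem_connectedComponentIn (hD.union hBcl) ?_ haB hbB ?_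
  · rw [← heq]
    exact isBounded_ball.subset sdiff_subset
  · refine HasLogOn.union hD hBcl ?_ (hL _ ?_ ?_) ?_
    · have : D ∩ (D' ∪ (ball p ε)ᶜ) = D' := by
        rw [inter_union_distrib_left, inter_eq_right.2 hD'D]
        exact union_eq_left.2 hsub
      rwa [this]
    · refine ContinuousOn.div (by fun_prop) (by fun_prop) fun z hz h0 => ?_
      rw [sub_eq_zero] at h0
      exact hb.2 (h0 ▸ hz)
    · intro z hz
      refine div_ne_zero (fun h0 => ?_) (fun h0 => ?_) <;> rw [sub_eq_zero] at h0
      exacts [ha.2 (h0 ▸ hz), hb.2 (h0 ▸ hz)]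
    · exact (convex_ball p δ).isPreconnected.hasLogOn_div hBcl
        (subset_compl_iff_disjoint_right.1 hδB) ha.1 hb.1

/-! ### Paths contain arcs -/

/-- An arc from `x` to `y`, parametrized by the unit interval. -/
structure IsArcFromTo {X : Type*} [TopologicalSpace X] (α : ℝ → X) (x y : X) : Prop where
  continuousOn : ContinuousOn α (Icc 0 1)
  injOn : InjOn α (Icc 0 1)
  source : α 0 = x
  target : α 1 = y

section MonotonePaths

variable {X : Type*} [PseudoMetricSpace X]

/-- The largest distance from `g q` reached by the path `g` between times `q` and `t`
(equal to `0` if `t ≤ q`). -/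
noncomputable def runningSup (g : ℝ → X) (q t : ℝ) : ℝ :=
  sSup ((fun u => dist (g q) (g (max q (min u t)))) '' Icc 0 1)

theorem continuous_runningSup {g : ℝ → X} (hg : Continuous g) (q : ℝ) :
    Continuous (runningSup g q) := by
  refine IsCompact.continuous_sSup (K := Icc (0 : ℝ) 1)
    (f := fun t u => dist (g q) (g (max q (min u t)))) isCompact_Icc ?_
  simp only [Function.HasUncurry.uncurry, id]
  fun_prop

theorem bddAbove_runningSup {g : ℝ → X} (hb : Bornology.IsBounded (range g)) (q t : ℝ) :
    BddAbove ((fun u => dist (g q) (g (max q (min u t)))) '' Icc 0 1) := by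
  refine ⟨Metric.diam (range g), ?_⟩
  rintro _ ⟨u, _, rfl⟩
  exact Metric.dist_le_diam_of_mem hb (mem_range_self _) (mem_range_self _)

theorem dist_le_runningSup {g : ℝ → X} (hb : Bornology.IsBounded (range g)) {q t v : ℝ}
    (hv : v ∈ Icc (0 : ℝ) 1) (hqv : q ≤ v) (hvt : v ≤ t) :
    dist (g q) (g v) ≤ runningSup g q t := by
  refine le_csSup (bddAbove_runningSup hb q t) ⟨v, hv, ?_⟩
  simp only
  rw [min_eq_left hvt, max_eq_right hqv]

theorem runningSup_le {g : ℝ → X} {q t c : ℝ} (ht : t ∈ Icc (0 : ℝ) 1) (hc : 0 ≤ c)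
    (h : ∀ v ∈ Icc (0 : ℝ) t, q ≤ v → dist (g q) (g v) ≤ c) : runningSup g q t ≤ c := by
  refine csSup_le (Nonempty.image _ ⟨0, by simp⟩) ?_
  rintro _ ⟨u, hu, rfl⟩
  rcases le_total q (min u t) with h1 | h1
  · simp only [max_eq_right h1]
    exact h _ ⟨le_min hu.1 ht.1, min_le_right _ _⟩ h1
  · simpa only [max_eq_left h1, dist_self] using hc

theorem runningSup_nonneg {g : ℝ → X} (q t : ℝ) : 0 ≤ runningSup g q t := by
  refine Real.sSup_nonneg ?_
  rintro _ ⟨u, _, rfl⟩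
  exact dist_nonneg

theorem runningSup_mono {g : ℝ → X} (hb : Bornology.IsBounded (range g)) {q s t : ℝ}
    (hs : s ∈ Icc (0 : ℝ) 1) (hst : s ≤ t) :
    runningSup g q s ≤ runningSup g q t :=
  runningSup_le hs (runningSup_nonneg q t) fun _ hv hqv =>
    dist_le_runningSup hb ⟨hv.1, hv.2.trans hs.2⟩ hqv (hv.2.trans hst)

/-- A path all of whose fibres are intervals has the same fibres as some continuous monotone
real function. -/
theorem exists_monotoneOn_fibers_eq {X : Type*} [MetricSpace X] {g : ℝ → X} (hg : Continuous g)
    (hb : Bornology.IsBounded (range g))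
    (hfib : ∀ s ∈ Icc (0 : ℝ) 1, ∀ t ∈ Icc (0 : ℝ) 1, g s = g t → ∀ v ∈ Icc s t, g v = g s) :
    ∃ φ : ℝ → ℝ, Continuous φ ∧ MonotoneOn φ (Icc 0 1) ∧
      ∀ s ∈ Icc (0 : ℝ) 1, ∀ t ∈ Icc (0 : ℝ) 1, φ s = φ t ↔ g s = g t := by
  let q : ℕ → ℝ := TopologicalSpace.denseSeq ℝ
  let m : ℕ → ℝ → ℝ := fun n t => (1 / 2 : ℝ) ^ n * runningSup g (q n) t
  have hmle : ∀ n t, runningSup g (q n) t ≤ Metric.diam (range g) := by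
    intro n t
    refine csSup_le (Nonempty.image _ ⟨0, by simp⟩) ?_
    rintro _ ⟨u, _, rfl⟩
    exact Metric.dist_le_diam_of_mem hb (mem_range_self _) (mem_range_self _)
  have hsum0 : Summable fun n : ℕ => (1 / 2 : ℝ) ^ n * Metric.diam (range g) :=
    summable_geometric_two.mul_right _
  have hnorm : ∀ n t, ‖m n t‖ ≤ (1 / 2 : ℝ) ^ n * Metric.diam (range g) := by
    intro n t
    rw [Real.norm_of_nonneg (mul_nonneg (by positivity) (runningSup_nonneg _ _))]
    exact mul_le_mul_of_nonneg_left (hmle n t) (by positivity)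
  have hsum : ∀ t, Summable fun n => m n t := fun t =>
    Summable.of_norm_bounded hsum0 fun n => hnorm n t
  have hmono : ∀ s ∈ Icc (0 : ℝ) 1, ∀ t ∈ Icc (0 : ℝ) 1, s ≤ t → ∀ n, m n s ≤ m n t :=
    fun s hs t ht hst n =>
      mul_le_mul_of_nonneg_left (runningSup_mono hb hs hst) (by positivity)
  have hφ : ∀ s ∈ Icc (0 : ℝ) 1, ∀ t ∈ Icc (0 : ℝ) 1, s ≤ t →
      ((∑' n, m n s) = ∑' n, m n t ↔ g s = g t) := by
    intro s hs t ht hst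
    constructor
    · intro h
      have heq : ∀ n, m n s = m n t := by
        intro n
        by_contra hne
        exact (Summable.tsum_lt_tsum (hmono s hs t ht hst)
          (lt_of_le_of_ne (hmono s hs t ht hst n) hne) (hsum s) (hsum t)).ne h
      rcases hst.eq_or_lt with rfl | hlt
      · rfl
      have hq : ∀ n, q n ∈ Ioo s t → g (q n) = g t := by
        intro n hn
        have h1 : runningSup g (q n) s = runningSup g (q n) t :=
          mul_left_cancel₀ (by positivity) (heq n)
        have h2 : runningSup g (q n) s ≤ 0 := runningSup_le hs le_rfl fun v hv hqv =>
          absurd (hqv.trans hv.2) (not_le.2 hn.1)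
        have h3 := dist_le_runningSup hb ht hn.2.le le_rfl
        exact dist_le_zero.1 (h3.trans (h1 ▸ h2))
      have hcl : s ∈ closure {x | g x = g t} := by
        have hsc : s ∈ closure (Ioo s t) := by
          rw [closure_Ioo hlt.ne]
          exact ⟨le_rfl, hst⟩
        have hd := (TopologicalSpace.denseRange_denseSeq ℝ).open_subset_closure_inter
          (isOpen_Ioo (a := s) (b := t))
        refine closure_mono ?_ (closure_minimal hd isClosed_closure hsc)
        rintro _ ⟨hx, n, rfl⟩
        exact hq n hx
      rwa [(isClosed_eq hg continuous_const).closure_eq] at hcl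
    · intro h
      have hc := hfib s hs t ht h
      refine tsum_congr fun n => le_antisymm (hmono s hs t ht hst n) ?_
      refine mul_le_mul_of_nonneg_left ?_ (by positivity)
      refine runningSup_le ht (runningSup_nonneg _ _) fun v hv hqv => ?_
      rcases le_total v s with hvs | hvs
      · exact dist_le_runningSup hb ⟨hv.1, hvs.trans hs.2⟩ hqv hvs
      · rw [hc v ⟨hvs, hv.2⟩]
        rcases le_total (q n) s with hqs | hqs
        · exact dist_le_runningSup hb hs hqs le_rfl
        · rw [hc (q n) ⟨hqs, hqv.trans hv.2⟩, dist_self]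
          exact runningSup_nonneg _ _
  refine ⟨fun t => ∑' n, m n t, ?_, ?_, ?_⟩
  · exact continuous_tsum (fun n => continuous_const.mul (continuous_runningSup hg _)) hsum0 hnorm
  · intro s hs t ht hst
    exact Summable.tsum_le_tsum (hmono s hs t ht hst) (hsum s) (hsum t)
  · intro s hs t ht
    rcases le_total s t with hst | hst
    · exact hφ s hs t ht hst
    · rw [eq_comm, hφ t ht s hs hst, eq_comm]

/-- A path with distinct ends all of whose fibres are intervals can be reparametrized as an arc. -/
theorem exists_isArcFromTo_of_fibers {X : Type*} [MetricSpace X] {g : ℝ → X} (hg : Continuous g)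
    (hb : Bornology.IsBounded (range g))
    (hfib : ∀ s ∈ Icc (0 : ℝ) 1, ∀ t ∈ Icc (0 : ℝ) 1, g s = g t → ∀ v ∈ Icc s t, g v = g s)
    (hne : g 0 ≠ g 1) :
    ∃ α : ℝ → X, IsArcFromTo α (g 0) (g 1) ∧ α '' Icc 0 1 ⊆ g '' Icc 0 1 := by
  obtain ⟨φ, hφc, hφm, hφ⟩ := exists_monotoneOn_fibers_eq hg hb hfib
  have h0 : (0 : ℝ) ∈ Icc (0 : ℝ) 1 := by simp
  have h1 : (1 : ℝ) ∈ Icc (0 : ℝ) 1 := by simp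
  have hlt : φ 0 < φ 1 := lt_of_le_of_ne (hφm h0 h1 zero_le_one) fun h =>
    hne ((hφ 0 h0 1 h1).1 h)
  have hsurj : ∀ y ∈ Icc (0 : ℝ) 1, ∃ x ∈ Icc (0 : ℝ) 1, φ x = φ 0 + y * (φ 1 - φ 0) := by
    intro y hy
    refine intermediate_value_Icc zero_le_one hφc.continuousOn ⟨?_, ?_⟩
    · nlinarith [hy.1]
    · nlinarith [hy.2]
  choose! ρ hρ hρφ using hsurj
  have hval : ∀ y ∈ Icc (0 : ℝ) 1, ∀ x ∈ Icc (0 : ℝ) 1, φ x = φ 0 + y * (φ 1 - φ 0) →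
      g (ρ y) = g x := fun y hy x hx h =>
    (hφ _ (hρ y hy) x hx).1 ((hρφ y hy).trans h.symm)
  refine ⟨fun y => g (ρ y), ⟨?_, ?_, ?_, ?_⟩, ?_⟩
  · rw [continuousOn_iff_isClosed]
    intro F hF
    refine ⟨(fun x => (φ x - φ 0) / (φ 1 - φ 0)) '' (Icc 0 1 ∩ g ⁻¹' F), ?_, ?_⟩
    · refine IsCompact.isClosed (IsCompact.image ?_ (by fun_prop))
      exact isCompact_Icc.inter_right (hF.preimage hg)
    · ext y
      have hpos : φ 1 - φ 0 ≠ 0 := (sub_pos.2 hlt).ne'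
      constructor
      · rintro ⟨hyF, hy⟩
        refine ⟨⟨ρ y, ⟨hρ y hy, hyF⟩, ?_⟩, hy⟩
        simp only
        rw [hρφ y hy, add_sub_cancel_left, mul_div_cancel_right₀ _ hpos]
      · rintro ⟨⟨x, ⟨hx, hxF⟩, rfl⟩, hy⟩
        refine ⟨?_, hy⟩
        simp only at hy ⊢
        rw [mem_preimage, hval _ hy x hx (by field_simp; ring)]
        exact hxF
  · intro y hy z hz hyz
    have h2 := (hφ _ (hρ y hy) _ (hρ z hz)).2 hyz
    rw [hρφ y hy, hρφ z hz] at h2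
    exact mul_right_cancel₀ (sub_pos.2 hlt).ne' (add_left_cancel h2)
  · exact hval 0 h0 0 h0 (by ring)
  · exact hval 1 h1 1 h1 (by ring)
  · rintro _ ⟨y, hy, rfl⟩
    exact mem_image_of_mem g (hρ y hy)

end MonotonePaths

section PathsContainArcs

variable {X : Type*} [MetricSpace X]

/-- Closed subsets of the unit interval containing its ends, such that `f` takes the same value
at both ends of every gap. -/
def gapClosedSets (f : ℝ → X) : Set (Set ℝ) :=
  {C | C ⊆ Icc 0 1 ∧ IsClosed C ∧ (0 : ℝ) ∈ C ∧ (1 : ℝ) ∈ C ∧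
    ∀ s ∈ C, ∀ t ∈ C, s < t → Ioo s t ∩ C = ∅ → f s = f t}

theorem sInter_mem_gapClosedSets {f : ℝ → X} (hf : ContinuousOn f (Icc 0 1)) {c : Set (Set ℝ)}
    (hcS : c ⊆ gapClosedSets f) (hchain : IsChain (· ⊆ ·) c) (hne : c.Nonempty) :
    ⋂₀ c ∈ gapClosedSets f := by
  obtain ⟨C₀, hC₀⟩ := hne
  have hsub : ⋂₀ c ⊆ Icc 0 1 := (sInter_subset_of_mem hC₀).trans (hcS hC₀).1
  refine ⟨hsub, isClosed_sInter fun C hC => (hcS hC).2.1,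
    mem_sInter.2 fun C hC => (hcS hC).2.2.1, mem_sInter.2 fun C hC => (hcS hC).2.2.2.1, ?_⟩
  intro s hs t ht hst hgap
  refine dist_le_zero.1 (le_of_forall_pos_le_add fun ε hε => ?_)
  have hcont : ∀ x ∈ Icc (0 : ℝ) 1, ∃ η > 0, ∀ y ∈ Icc (0 : ℝ) 1, dist y x < η →
      dist (f y) (f x) < ε / 2 := fun x hx =>
    Metric.continuousWithinAt_iff.1 (hf x hx) (ε / 2) (half_pos hε) |>.imp
      fun η h => ⟨h.1, fun y hy hyx => h.2 hy hyx⟩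
  obtain ⟨η₁, hη₁, H₁⟩ := hcont s (hsub hs)
  obtain ⟨η₂, hη₂, H₂⟩ := hcont t (hsub ht)
  obtain ⟨η, hη, hηle⟩ : ∃ η > 0, η < η₁ ∧ η < η₂ ∧ η < (t - s) / 2 :=
    ⟨min η₁ (min η₂ ((t - s) / 2)) / 2, by
      have : 0 < min η₁ (min η₂ ((t - s) / 2)) := lt_min hη₁ (lt_min hη₂ (by linarith))
      refine ⟨half_pos this, ?_, ?_, ?_⟩
      · linarith [min_le_left η₁ (min η₂ ((t - s) / 2))]
      · linarith [min_le_right η₁ (min η₂ ((t - s) / 2)), min_le_left η₂ ((t - s) / 2)]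
      · linarith [min_le_right η₁ (min η₂ ((t - s) / 2)), min_le_right η₂ ((t - s) / 2)]⟩
  obtain ⟨C, hC, hCe⟩ : ∃ C ∈ c, C ∩ Icc (s + η) (t - η) = ∅ := by
    by_contra! hcon
    have : Nonempty c := ⟨⟨C₀, hC₀⟩⟩
    obtain ⟨x, hx⟩ := IsCompact.nonempty_iInter_of_directed_nonempty_isCompact_isClosed
      (fun C : c => (C : Set ℝ) ∩ Icc (s + η) (t - η))
      (by
        intro A B
        rcases hchain.total A.2 B.2 with h | h
        · exact ⟨A, subset_rfl, inter_subset_inter_left _ h⟩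
        · exact ⟨B, inter_subset_inter_left _ h, subset_rfl⟩)
      (fun C => hcon C C.2)
      (fun C => isCompact_Icc.inter_left (hcS C.2).2.1)
      (fun C => (hcS C.2).2.1.inter isClosed_Icc)
    rw [mem_iInter] at hx
    have hx1 : x ∈ ⋂₀ c := mem_sInter.2 fun C hC => (hx ⟨C, hC⟩).1
    have hx2 := (hx ⟨C₀, hC₀⟩).2
    have : x ∈ Ioo s t ∩ ⋂₀ c := ⟨⟨by linarith [hx2.1], by linarith [hx2.2]⟩, hx1⟩
    rw [hgap] at this
    exact this
  obtain ⟨hC01, hCcl, -, -, hCgap⟩ := hcS hC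
  have hsC : s ∈ C := mem_sInter.1 hs C hC
  have htC : t ∈ C := mem_sInter.1 ht C hC
  have hk1 : IsCompact (C ∩ Icc s (s + η)) := isCompact_Icc.inter_left hCcl
  have hk2 : IsCompact (C ∩ Icc (t - η) t) := isCompact_Icc.inter_left hCcl
  obtain ⟨s', ⟨hs'C, hs'⟩, hs'max⟩ := hk1.exists_isGreatest ⟨s, hsC, le_rfl, by linarith⟩
  obtain ⟨t', ⟨ht'C, ht'⟩, ht'min⟩ := hk2.exists_isLeast ⟨t, htC, by linarith, le_rfl⟩
  have heq : f s' = f t' := by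
    refine hCgap s' hs'C t' ht'C (by linarith [hs'.2, ht'.1]) ?_
    rw [eq_empty_iff_forall_notMem]
    rintro x ⟨hx, hxC⟩
    rcases lt_or_ge (s + η) x with h1 | h1
    · rcases lt_or_ge x (t - η) with h2 | h2
      · exact (hCe ▸ (⟨hxC, h1.le, h2.le⟩ : x ∈ C ∩ Icc (s + η) (t - η)) : x ∈ (∅ : Set ℝ))
      · exact absurd (ht'min ⟨hxC, h2, hx.2.le.trans ht'.2⟩) (not_le.2 hx.2)
    · exact absurd (hs'max ⟨hxC, hs'.1.trans hx.1.le, h1⟩) (not_le.2 hx.1)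
  have d1 := H₁ s' (hC01 hs'C) (by
    rw [Real.dist_eq, abs_of_nonneg (by linarith [hs'.1])]; linarith [hs'.2, hηle.1])
  have d2 := H₂ t' (hC01 ht'C) (by
    rw [Real.dist_eq, abs_of_nonpos (by linarith [ht'.2])]; linarith [ht'.1, hηle.2.1])
  rw [heq] at d1
  have := dist_triangle_left (f s) (f t) (f t')
  linarith

theorem exists_gapClosedSet_separating {f : ℝ → X} (hf : ContinuousOn f (Icc 0 1)) :
    ∃ C ∈ gapClosedSets f, ∀ s ∈ C, ∀ t ∈ C, s < t → f s = f t → Ioo s t ∩ C = ∅ := by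
  obtain ⟨C, -, hC⟩ := zorn_superset_nonempty (gapClosedSets f)
    (fun c hcS hchain hne => ⟨⋂₀ c, sInter_mem_gapClosedSets hf hcS hchain hne,
      fun s hs => sInter_subset_of_mem hs⟩)
    (Icc 0 1) ⟨subset_rfl, isClosed_Icc, by simp, by simp, by
      intro s hs t ht hst he
      have : (s + t) / 2 ∈ Ioo s t ∩ Icc 0 1 :=
        ⟨⟨by linarith, by linarith⟩, by linarith [hs.1, ht.1], by linarith [hs.2, ht.2]⟩
      rw [he] at this
      exact this.elim⟩
  refine ⟨C, hC.1, fun s hs t ht hst heq => ?_⟩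
  obtain ⟨hC01, hCcl, hC0, hC1, hCgap⟩ := hC.1
  have hmem : C \ Ioo s t ∈ gapClosedSets f := by
    refine ⟨sdiff_subset.trans hC01, hCcl.sdiff isOpen_Ioo, ⟨hC0, fun h => ?_⟩,
      ⟨hC1, fun h => ?_⟩, ?_⟩
    · linarith [h.1, (hC01 hs).1]
    · linarith [h.2, (hC01 ht).2]
    · rintro u ⟨huC, hu⟩ v ⟨hvC, hv⟩ huv hgap
      rcases (Ioo u v ∩ C).eq_empty_or_nonempty with he | ⟨w, hw, hwC⟩
      · exact hCgap u huC v hvC huv he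
      have hnot : ∀ x ∈ C, x ∉ Ioo s t → x ∉ Ioo u v := fun x hxC hx hxuv => by
        have : x ∈ Ioo u v ∩ (C \ Ioo s t) := ⟨hxuv, hxC, hx⟩
        rw [hgap] at this
        exact this
      have hwst : w ∈ Ioo s t := by
        by_contra h
        exact hnot w hwC h hw
      have hs' := hnot s hs fun h => lt_irrefl _ h.1
      have ht' := hnot t ht fun h => lt_irrefl _ h.2
      have hus : u = s := by
        refine le_antisymm ?_ ?_
        · by_contra h
          exact hu ⟨not_le.1 h, hw.1.trans hwst.2⟩
        · by_contra h
          exact hs' ⟨not_le.1 h, hwst.1.trans hw.2⟩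
      have hvt : v = t := by
        refine le_antisymm ?_ ?_
        · by_contra h
          exact ht' ⟨hw.1.trans hwst.2, not_le.1 h⟩
        · by_contra h
          exact hv ⟨hwst.1.trans hw.2, not_le.1 h⟩
      rw [hus, hvt, heq]
  rw [eq_empty_iff_forall_notMem]
  rintro x ⟨hx, hxC⟩
  exact (hC.2 hmem sdiff_subset hxC).2 hx

theorem exists_isArcFromTo_of_continuousOn {f : ℝ → X} (hf : ContinuousOn f (Icc 0 1))
    (hne : f 0 ≠ f 1) :
    ∃ α : ℝ → X, IsArcFromTo α (f 0) (f 1) ∧ α '' Icc 0 1 ⊆ f '' Icc 0 1 := by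
  obtain ⟨C, ⟨hC01, hCcl, hC0, hC1, hCgap⟩, hsep⟩ := exists_gapClosedSet_separating hf
  have hL : ∀ x ∈ Icc (0 : ℝ) 1, ∃ l, IsGreatest (C ∩ Icc 0 x) l := fun x hx =>
    (isCompact_Icc.inter_left hCcl).exists_isGreatest ⟨0, hC0, le_rfl, hx.1⟩
  have hR : ∀ x ∈ Icc (0 : ℝ) 1, ∃ r, IsLeast (C ∩ Icc x 1) r := fun x hx =>
    (isCompact_Icc.inter_left hCcl).exists_isLeast ⟨1, hC1, hx.2, le_rfl⟩
  choose! l hl using hL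
  choose! r hr using hR
  have hlr : ∀ x ∈ Icc (0 : ℝ) 1, f (l x) = f (r x) := by
    intro x hx
    obtain ⟨⟨hlC, hl0, hlx⟩, hlm⟩ := hl x hx
    obtain ⟨⟨hrC, hrx, hr1⟩, hrm⟩ := hr x hx
    rcases (hlx.trans hrx).eq_or_lt with h | h
    · rw [h]
    · refine hCgap _ hlC _ hrC h ?_
      rw [eq_empty_iff_forall_notMem]
      rintro y ⟨hy, hyC⟩
      rcases le_total y x with hyx | hyx
      · exact absurd (hlm ⟨hyC, (hC01 hyC).1, hyx⟩) (not_le.2 hy.1)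
      · exact absurd (hrm ⟨hyC, hyx, (hC01 hyC).2⟩) (not_le.2 hy.2)
  have hleq : ∀ x ∈ Icc (0 : ℝ) 1, ∀ y ∈ Icc (0 : ℝ) 1, x ≤ y → l y < x → l y = l x := by
    intro x hx y hy hxy h
    refine le_antisymm ((hl x hx).2 ⟨(hl y hy).1.1, (hl y hy).1.2.1, h.le⟩) ?_
    exact (hl y hy).2 ⟨(hl x hx).1.1, (hl x hx).1.2.1, (hl x hx).1.2.2.trans hxy⟩
  have hrle : ∀ x ∈ Icc (0 : ℝ) 1, ∀ y ∈ Icc (0 : ℝ) 1, x ≤ l y → r x ≤ l y :=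
    fun x hx y hy h => (hr x hx).2 ⟨(hl y hy).1.1, h, (hl y hy).1.2.2.trans hy.2⟩
  have hgc : ContinuousOn (fun x => f (l x)) (Icc 0 1) := by
    have huc := isCompact_Icc.uniformContinuousOn_of_continuous hf
    refine UniformContinuousOn.continuousOn (Metric.uniformContinuousOn_iff.2 fun ε hε => ?_)
    obtain ⟨δ, hδ, H⟩ := Metric.uniformContinuousOn_iff.1 huc ε hε
    have key : ∀ x ∈ Icc (0 : ℝ) 1, ∀ y ∈ Icc (0 : ℝ) 1, x ≤ y → y - x < δ →
        dist (f (l x)) (f (l y)) < ε := by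
      intro x hx y hy hxy hd
      rcases lt_or_ge (l y) x with h | h
      · rw [hleq x hx y hy hxy h, dist_self]
        exact hε
      · rw [hlr x hx]
        have hry := hrle x hx y hy h
        refine H _ (hC01 (hr x hx).1.1) _ (hC01 (hl y hy).1.1) ?_
        rw [Real.dist_eq, abs_of_nonpos (by linarith)]
        linarith [(hr x hx).1.2.1, (hl y hy).1.2.2]
    refine ⟨δ, hδ, fun x hx y hy hxy => ?_⟩
    rw [Real.dist_eq, abs_lt] at hxy
    rcases le_total x y with h | h
    · exact key x hx y hy h (by linarith)
    · rw [dist_comm]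
      exact key y hy x hx h (by linarith)
  have hgfib : ∀ s ∈ Icc (0 : ℝ) 1, ∀ t ∈ Icc (0 : ℝ) 1, f (l s) = f (l t) →
      ∀ v ∈ Icc s t, f (l v) = f (l s) := by
    intro s hs t ht heq v hv
    have hv01 : v ∈ Icc (0 : ℝ) 1 := ⟨hs.1.trans hv.1, hv.2.trans ht.2⟩
    rcases lt_or_ge (l v) s with h | h
    · rw [hleq s hs v hv01 hv.1 h]
    · have h1 := hrle s hs v hv01 h
      have h2 : l v ≤ l t := (hl t ht).2
        ⟨(hl v hv01).1.1, (hl v hv01).1.2.1, (hl v hv01).1.2.2.trans hv.2⟩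
      rcases h1.eq_or_lt with h1 | h1
      · rw [← h1, hlr s hs]
      rcases h2.eq_or_lt with h2 | h2
      · rw [h2, heq]
      have hmem : l v ∈ Ioo (r s) (l t) ∩ C := ⟨⟨h1, h2⟩, (hl v hv01).1.1⟩
      rw [hsep _ (hr s hs).1.1 _ (hl t ht).1.1 (h1.trans h2) (by rw [← hlr s hs, heq])] at hmem
      exact hmem.elim
  have hl0 : l 0 = 0 := le_antisymm (hl 0 (by simp)).1.2.2 (hl 0 (by simp)).1.2.1
  have hl1 : l 1 = 1 := le_antisymm (hl 1 (by simp)).1.2.2 ((hl 1 (by simp)).2 ⟨hC1, by simp⟩)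
  let g : ℝ → X := IccExtend (zero_le_one' ℝ) ((Icc (0 : ℝ) 1).domRestrict fun x => f (l x))
  have hgeq : ∀ x ∈ Icc (0 : ℝ) 1, g x = f (l x) := fun x hx => by
    simp only [g, IccExtend_of_mem _ _ hx, domRestrict_apply]
  have hgcont : Continuous g := (continuousOn_iff_continuous_domRestrict.1 hgc).Icc_extend'
  have hgb : Bornology.IsBounded (range g) := by
    simp only [g, IccExtend_range, range_domRestrict]
    exact (isCompact_Icc.image_of_continuousOn hgc).isBounded
  obtain ⟨α, hα, hαg⟩ := exists_isArcFromTo_of_fibers hgcont hgb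
    (fun s hs t ht h v hv => by
      rw [hgeq s hs, hgeq t ht] at h
      rw [hgeq v ⟨hs.1.trans hv.1, hv.2.trans ht.2⟩, hgeq s hs]
      exact hgfib s hs t ht h v hv)
    (by rwa [hgeq 0 (by simp), hgeq 1 (by simp), hl0, hl1])
  rw [hgeq 0 (by simp), hgeq 1 (by simp), hl0, hl1] at hα
  refine ⟨α, hα, hαg.trans ?_⟩
  rintro _ ⟨x, hx, rfl⟩
  exact ⟨l x, hC01 (hl x hx).1.1, (hgeq x hx).symm⟩

end PathsContainArcs

/-! ### Paths in open sets avoiding countable sets -/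

theorem isPathConnected_ball_sdiff_countable (c : ℂ) {r : ℝ} (hr : 0 < r) {T : Set ℂ}
    (hT : T.Countable) : IsPathConnected (ball c r \ T) := by
  let e := OpenPartialHomeomorph.univBall c r
  have hsrc : e.source = univ := OpenPartialHomeomorph.univBall_source c r
  have htgt : e.target = ball c r := OpenPartialHomeomorph.univBall_target c hr
  have hinj : Function.Injective e := by
    rw [← injOn_univ, ← hsrc]
    exact e.injOn
  have h1 : IsPathConnected (e ⁻¹' T)ᶜ :=
    (hT.preimage_of_injOn hinj.injOn).isPathConnected_compl_of_one_lt_rank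
      (by rw [Complex.rank_real_complex]; norm_num)
  have h2 := h1.image (OpenPartialHomeomorph.continuous_univBall c r)
  have h3 : e '' (e ⁻¹' T)ᶜ = ball c r \ T := by
    rw [← preimage_compl, image_preimage_eq_inter_range, ← image_univ, ← hsrc,
      e.image_source_eq_target, htgt, inter_comm]
    rfl
  rwa [← h3]

theorem IsPreconnected.joinedIn_sdiff_countable {U T : Set ℂ} (hc : IsPreconnected U)
    (hU : IsOpen U) (hT : T.Countable) {a b : ℂ} (ha : a ∈ U \ T) (hb : b ∈ U \ T) :
    JoinedIn (U \ T) a b := by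
  have key := hc.induction₂ (fun x y => ∃ r > 0, ∀ x' ∈ ball x r \ T, ∀ y' ∈ ball y r \ T,
    JoinedIn (U \ T) x' y') ?_ ?_ ?_ ha.1 hb.1
  · obtain ⟨r, hr, H⟩ := key
    exact H a ⟨mem_ball_self hr, ha.2⟩ b ⟨mem_ball_self hr, hb.2⟩
  · intro x hx
    obtain ⟨r, hr, hrU⟩ := Metric.isOpen_iff.1 hU x hx
    filter_upwards [eventually_nhdsWithin_of_eventually_nhds
      (Metric.ball_mem_nhds x (half_pos hr))] with y hy
    refine ⟨r / 2, half_pos hr, fun x' hx' y' hy' => ?_⟩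
    refine ((isPathConnected_ball_sdiff_countable x hr hT).joinedIn x'
      ⟨ball_subset_ball (by linarith) hx'.1, hx'.2⟩ y' ⟨?_, hy'.2⟩).mono
      (sdiff_subset_sdiff_left hrU)
    have h1 := mem_ball.1 hy'.1
    have h2 := mem_ball.1 hy
    exact mem_ball.2 ((dist_triangle y' y x).trans_lt (by linarith))
  · rintro x y z - - - ⟨r, hr, H⟩ ⟨s, hs, H'⟩
    obtain ⟨w, hw, hwT⟩ :=
      (isPathConnected_ball_sdiff_countable y (lt_min hr hs) hT).nonempty
    refine ⟨min r s, lt_min hr hs, fun x' hx' z' hz' => ?_⟩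
    exact (H x' ⟨ball_subset_ball (min_le_left _ _) hx'.1, hx'.2⟩ w
        ⟨ball_subset_ball (min_le_left _ _) hw, hwT⟩).trans
      (H' w ⟨ball_subset_ball (min_le_right _ _) hw, hwT⟩ z'
        ⟨ball_subset_ball (min_le_right _ _) hz'.1, hz'.2⟩)
  · rintro x y - - ⟨r, hr, H⟩
    exact ⟨r, hr, fun y' hy' x' hx' => (H x' hx' y' hy').symm⟩

/-- Infinitely many paths shrinking to a point can be concatenated. -/
theorem joinedIn_of_tendsto {X : Type*} [MetricSpace X] {S : Set X} {p : X} {x : ℕ → X}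
    {ε : ℕ → ℝ} (hε : Filter.Tendsto ε Filter.atTop (nhds 0)) (hp : p ∈ S)
    (h : ∀ n, JoinedIn (S ∩ ball p (ε n)) (x n) (x (n + 1))) : JoinedIn S (x 0) p := by
  let γ : ∀ n, Path (x n) (x (n + 1)) := fun n => (h n).somePath
  have hγ : ∀ n t, (γ n).extend t ∈ S ∩ ball p (ε n) := by
    intro n t
    obtain ⟨u, hu⟩ : (γ n).extend t ∈ range (γ n) := by
      rw [← (γ n).extend_range]
      exact mem_range_self t
    rw [← hu]
    exact (h n).somePath_mem u
  let G : ℝ → X := fun t => (γ ⌊t⌋₊).extend (t - ⌊t⌋₊)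
  have hGn : ∀ n : ℕ, EqOn G (fun t => (γ n).extend (t - n)) (Icc (n : ℝ) (n + 1)) := by
    intro n t ht
    rcases ht.2.eq_or_lt with h1 | h1
    · have hfl : ⌊t⌋₊ = n + 1 := by
        rw [h1]
        exact_mod_cast Nat.floor_natCast (R := ℝ) (n + 1)
      have e1 : t - (n + 1 : ℕ) = 0 := by push_cast; linarith
      have e2 : t - n = 1 := by linarith
      simp only [G]
      rw [hfl, e1, e2, Path.extend_zero, Path.extend_one]
    · have hfl : ⌊t⌋₊ = n := (Nat.floor_eq_iff (n.cast_nonneg.trans ht.1)).2 ⟨ht.1, h1⟩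
      simp only [G]
      rw [hfl]
  have hGc : ContinuousOn G (Ici 0) := by
    have hcov : Ici (0 : ℝ) ⊆ ⋃ n : ℕ, Icc (n : ℝ) (n + 1) := fun t ht =>
      mem_iUnion.2 ⟨⌊t⌋₊, Nat.floor_le ht, (Nat.lt_floor_add_one t).le⟩
    refine ContinuousOn.mono (LocallyFinite.continuousOn_iUnion ?_ (fun n => isClosed_Icc)
      fun n => ContinuousOn.congr ?_ (hGn n)) hcov
    · intro t
      refine ⟨Iio (t + 1), Iio_mem_nhds (by linarith), (finite_Iio (⌈t⌉₊ + 1)).subset ?_⟩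
      rintro n ⟨y, hy, hy'⟩
      have h1 : (n : ℝ) < t + 1 := hy.1.trans_lt hy'
      have h2 : (n : ℝ) < (⌈t⌉₊ + 1 : ℕ) := by
        push_cast
        linarith [Nat.le_ceil t]
      exact_mod_cast h2
    · exact ((γ n).continuous_extend.comp (continuous_id.sub continuous_const)).continuousOn
  let f : ℝ → X := fun s => if s < 1 then G (s / (1 - s)) else p
  have hfG : ∀ s < 1, f s = G (s / (1 - s)) := fun s hs => if_pos hs
  have hf1 : f 1 = p := if_neg (lt_irrefl _)
  refine JoinedIn.ofLine (f := f) ?_ ?_ hf1 ?_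
  · intro s hs
    rcases hs.2.eq_or_lt with rfl | hlt
    · refine ContinuousAt.continuousWithinAt ?_
      rw [Metric.continuousAt_iff]
      intro e he
      obtain ⟨N, hN⟩ := (hε.eventually (gt_mem_nhds he)).exists_forall_of_atTop
      refine ⟨1 / (N + 1), by positivity, fun {y} hy => ?_⟩
      rw [hf1]
      by_cases hy1 : y < 1
      · rw [hfG y hy1]
        have hd : 1 - y < 1 / (N + 1) := by
          rw [Real.dist_eq, abs_of_neg (by linarith)] at hy
          linarith
        have hpos : 0 < 1 - y := by linarith
        have hle : (N : ℝ) ≤ y / (1 - y) := by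
          rw [le_div_iff₀ hpos]
          rw [lt_div_iff₀ (by positivity)] at hd
          nlinarith
        have := (hγ ⌊y / (1 - y)⌋₊ (y / (1 - y) - ⌊y / (1 - y)⌋₊)).2
        exact (mem_ball.1 this).trans (hN _ (Nat.le_floor hle))
      · have : f y = p := if_neg hy1
        rw [this, dist_self]
        exact he
    · have hmem : s ∈ Iio (1 : ℝ) ∩ unitInterval := ⟨hlt, hs⟩
      have hc : ContinuousOn (fun s : ℝ => G (s / (1 - s))) (Iio 1 ∩ unitInterval) := by
        refine hGc.comp (ContinuousOn.div (by fun_prop) (by fun_prop) ?_) ?_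
        · rintro x ⟨hx, -⟩
          exact (sub_pos.2 hx).ne'
        · rintro x ⟨hx, hx0, -⟩
          exact div_nonneg hx0 (sub_pos.2 hx).le
      have h2 := (hc.congr fun x hx => hfG x hx.1) s hmem
      refine h2.mono_of_mem_nhdsWithin ?_
      rw [inter_comm]
      exact Filter.inter_mem self_mem_nhdsWithin (mem_nhdsWithin_of_mem_nhds (Iio_mem_nhds hlt))
  · rw [hfG 0 one_pos]
    simp [G]
  · rintro _ ⟨s, hs, rfl⟩
    rcases hs.2.eq_or_lt with rfl | hlt
    · rwa [hf1]
    · rw [hfG s hlt]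
      exact (hγ _ _).1

theorem UniformlyAccessible.joinedIn {K T : Set ℂ} {p a : ℂ} (hp : UniformlyAccessible K p)
    (hK : IsClosed K) (hc : IsPreconnected Kᶜ) (hpcl : p ∈ closure Kᶜ) (hT : T.Countable)
    (ha : a ∈ Kᶜ \ T) : JoinedIn (insert p (Kᶜ \ T)) a p := by
  choose! δ hδ H using hp
  let ε : ℕ → ℝ := fun n => 1 / ((n : ℝ) + 1)
  have hεpos : ∀ n, 0 < ε n := fun n => by positivity
  have hx : ∀ n, ∃ x ∈ Kᶜ \ T, ∀ m ≤ n, x ∈ ball p (δ (ε m)) := by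
    intro n
    have h1 : (⋂ m ∈ Iic n, ball p (δ (ε m))) ∈ nhds p :=
      (Filter.biInter_mem (finite_Iic n)).2 fun m _ => ball_mem_nhds p (hδ _ (hεpos m))
    obtain ⟨V, hV, hVo, hpV⟩ := _root_.mem_nhds_iff.1 h1
    obtain ⟨y, hyV, hyK⟩ := mem_closure_iff.1 hpcl V hVo hpV
    obtain ⟨x, ⟨hxV, hxK⟩, hxT⟩ := (hT.dense_compl ℝ).inter_open_nonempty _
      (hVo.inter hK.isOpen_compl) ⟨y, hyV, hyK⟩
    refine ⟨x, ⟨hxK, hxT⟩, fun m hm => ?_⟩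
    exact mem_iInter₂.1 (hV hxV) m hm
  choose x hxK hxδ using hx
  have hjoin : ∀ n, JoinedIn (insert p (Kᶜ \ T) ∩ ball p (ε n)) (x n) (x (n + 1)) := by
    intro n
    have hm := H (ε n) (hεpos n) (x n) ⟨hxδ n n le_rfl, (hxK n).1⟩ (x (n + 1))
      ⟨hxδ (n + 1) n n.le_succ, (hxK (n + 1)).1⟩
    have hsub := connectedComponentIn_subset (ball p (ε n) \ K) (x n)
    have hself : x n ∈ connectedComponentIn (ball p (ε n) \ K) (x n) :=
      mem_connectedComponentIn (connectedComponentIn_nonempty_iff.1 ⟨_, hm⟩)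
    refine (isPreconnected_connectedComponentIn.joinedIn_sdiff_countable
      (isOpen_ball.sdiff hK).connectedComponentIn hT ⟨hself, (hxK n).2⟩
      ⟨hm, (hxK (n + 1)).2⟩).mono ?_
    rintro z ⟨hz, hzT⟩
    exact ⟨Or.inr ⟨(hsub hz).2, hzT⟩, (hsub hz).1⟩
  have h0 := (hc.joinedIn_sdiff_countable hK.isOpen_compl hT ha (hxK 0)).mono
    (subset_insert p _)
  exact h0.trans (joinedIn_of_tendsto tendsto_one_div_add_atTop_nhds_zero_nat
    (mem_insert _ _) hjoin)

/-- Two distinct accessible boundary points of a connected open set are the ends of an arc through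
this set avoiding a given countable set. -/
theorem exists_isArcFromTo_of_uniformlyAccessible {K T : Set ℂ} {c p : ℂ} (hK : IsClosed K)
    (hconn : IsPreconnected Kᶜ) (hT : T.Countable) (hcp : c ≠ p)
    (hc : UniformlyAccessible K c) (hccl : c ∈ closure Kᶜ)
    (hp : UniformlyAccessible K p) (hpcl : p ∈ closure Kᶜ) :
    ∃ α : ℝ → ℂ, IsArcFromTo α c p ∧ ∀ t ∈ Ioo (0 : ℝ) 1, α t ∉ K ∧ α t ∉ T := by
  obtain ⟨y, -, hyK⟩ := mem_closure_iff.1 hccl univ isOpen_univ (mem_univ c)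
  obtain ⟨a, haK, haT⟩ := (hT.dense_compl ℝ).inter_open_nonempty _ hK.isOpen_compl ⟨y, hyK⟩
  have h1 := (hc.joinedIn hK hconn hccl hT ⟨haK, haT⟩).symm
  have h2 := hp.joinedIn hK hconn hpcl hT ⟨haK, haT⟩
  have h3 : JoinedIn (insert c (insert p (Kᶜ \ T))) c p :=
    (h1.mono (insert_subset_insert (subset_insert _ _))).trans (h2.mono (subset_insert _ _))
  let γ := h3.somePath
  obtain ⟨α, hα, hsub⟩ := exists_isArcFromTo_of_continuousOn (f := γ.extend)
    γ.continuous_extend.continuousOn (by simpa using hcp)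
  rw [Path.extend_zero, Path.extend_one] at hα
  refine ⟨α, hα, fun t ht => ?_⟩
  have ht01 : t ∈ Icc (0 : ℝ) 1 := Ioo_subset_Icc_self ht
  obtain ⟨u, hu, hue⟩ := hsub (mem_image_of_mem α ht01)
  have hmem : α t ∈ insert c (insert p (Kᶜ \ T)) := by
    rw [← hue, Path.extend_apply γ hu]
    exact h3.somePath_mem _
  rcases hmem with h | h | h
  · rw [← hα.source] at h
    exact absurd (hα.injOn ht01 (by simp) h) ht.1.ne'
  · rw [← hα.target] at h
    exact absurd (hα.injOn ht01 (by simp) h) ht.2.ne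
  · exact h

/-! ### Disjoint arcs between discs in the plane -/

/-- The point `p` of `K` is an accessible boundary point of `K`. -/
structure IsAccessiblePoint (K : Set ℂ) (p : ℂ) : Prop where
  mem : p ∈ K
  mem_closure_compl : p ∈ closure Kᶜ
  uniformlyAccessible : UniformlyAccessible K p

theorem IsAccessiblePoint.union {K F : Set ℂ} {p : ℂ} (h : IsAccessiblePoint K p)
    (hF : IsClosed F) (hp : p ∉ F) : IsAccessiblePoint (K ∪ F) p := by
  refine ⟨Or.inl h.mem, ?_, h.uniformlyAccessible.union hF hp⟩
  rw [compl_union, inter_comm]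
  exact hF.isOpen_compl.inter_closure ⟨hp, h.mem_closure_compl⟩

theorem isAccessiblePoint_image_closedBall {E : Type*} [NormedAddCommGroup E]
    [InnerProductSpace ℝ E] [FiniteDimensional ℝ E] {f : E → ℂ}
    (hf : ContinuousOn f (closedBall 0 1)) (hinj : InjOn f (closedBall 0 1)) {w : E}
    (hw : ‖w‖ = 1) (hcl : f w ∈ closure (f '' closedBall 0 1)ᶜ) :
    IsAccessiblePoint (f '' closedBall 0 1) (f w) := by
  have hcomp : IsCompact (closedBall (0 : E) 1) := isCompact_closedBall 0 1
  have hwB : w ∈ closedBall (0 : E) 1 := by simp [hw]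
  refine ⟨mem_image_of_mem f hwB, hcl, LogTrivial.uniformlyAccessible
    (hcomp.image_of_continuousOn hf).isClosed
    (((convex_closedBall 0 1).logTrivial hcomp).image hcomp hf hinj) fun ε hε => ?_⟩
  have hinner : Continuous fun x : E => inner ℝ w x := by fun_prop
  have hlt : ∀ x ∈ closedBall (0 : E) 1, x ≠ w → inner ℝ w x < 1 := by
    intro x hx hxw
    have h1 := norm_sub_sq_real w x
    have h2 : 0 < ‖w - x‖ := norm_pos_iff.2 (sub_ne_zero.2 hxw.symm)
    have h3 : ‖x‖ ≤ 1 := by simpa using hx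
    have h4 := norm_nonneg x
    rw [hw] at h1
    nlinarith
  obtain ⟨η, hη, hηsub⟩ : ∃ η < (1 : ℝ), ∀ x ∈ closedBall (0 : E) 1, f x ∉ ball (f w) ε →
      inner ℝ w x ≤ η := by
    obtain ⟨u, hu, hfu⟩ := continuousOn_iff_isClosed.1 hf _
      (isOpen_ball (x := f w) (ε := ε)).isClosed_compl
    have hK : IsCompact (closedBall (0 : E) 1 ∩ u) := hcomp.inter_right hu
    have hmem : ∀ x ∈ closedBall (0 : E) 1, f x ∉ ball (f w) ε ↔ x ∈ u := fun x hx => by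
      have := Set.ext_iff.1 hfu x
      simp only [mem_inter_iff, mem_preimage, mem_compl_iff, hx, and_true] at this
      exact this
    rcases (closedBall (0 : E) 1 ∩ u).eq_empty_or_nonempty with he | hne
    · refine ⟨0, one_pos, fun x hx hfx => ?_⟩
      have : x ∈ closedBall (0 : E) 1 ∩ u := ⟨hx, (hmem x hx).1 hfx⟩
      rw [he] at this
      exact this.elim
    · obtain ⟨y, hy, hymax⟩ := hK.exists_isMaxOn hne hinner.continuousOn
      refine ⟨inner ℝ w y, hlt y hy.1 ?_, fun x hx hfx => hymax ⟨hx, (hmem x hx).1 hfx⟩⟩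
      rintro rfl
      exact (hmem y hy.1).2 hy.2 (mem_ball_self hε)
  have hsub : closedBall (0 : E) 1 ∩ {x | inner ℝ w x ≤ η} ⊆ closedBall 0 1 := inter_subset_left
  have hconv : Convex ℝ (closedBall (0 : E) 1 ∩ {x | inner ℝ w x ≤ η}) :=
    (convex_closedBall 0 1).inter (convex_halfSpace_le (innerSL ℝ w).toLinearMap.isLinear η)
  have hcompact : IsCompact (closedBall (0 : E) 1 ∩ {x | inner ℝ w x ≤ η}) :=
    hcomp.inter_right (isClosed_le hinner continuous_const)
  refine ⟨f '' (closedBall 0 1 ∩ {x | inner ℝ w x ≤ η}), image_mono hsub,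
    (hcompact.image_of_continuousOn (hf.mono hsub)).isClosed,
    hconv.isPreconnected.image _ (hf.mono hsub), ?_, ?_⟩
  · rintro ⟨x, ⟨hx, hxη⟩, hxw⟩
    rw [hinj hx hwB hxw, mem_ofPred_eq, real_inner_self_eq_norm_sq, hw] at hxη
    linarith
  · rintro _ ⟨⟨x, hx, rfl⟩, hxε⟩
    exact ⟨x, ⟨hx, hηsub x hx hxε⟩, rfl⟩

theorem isAccessiblePoint_closedBall (c : ℂ) {r : ℝ} (hr : 0 < r) {u : ℂ} (hu : ‖u‖ = 1) :
    IsAccessiblePoint (closedBall c r) (c + r * u) := by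
  have hr' : (r : ℂ) ≠ 0 := by exact_mod_cast hr.ne'
  have himg : (fun z : ℂ => c + r * z) '' closedBall 0 1 = closedBall c r := by
    ext z
    simp only [mem_image, mem_closedBall, dist_eq_norm, sub_zero]
    constructor
    · rintro ⟨x, hx, rfl⟩
      rw [add_sub_cancel_left, norm_mul, Complex.norm_real, Real.norm_of_nonneg hr.le]
      nlinarith
    · intro hz
      refine ⟨(z - c) / r, ?_, by field_simp; ring⟩
      rwa [norm_div, Complex.norm_real, Real.norm_of_nonneg hr.le, div_le_one hr]
  have hinj : Function.Injective fun z : ℂ => c + r * z := fun x y h =>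
    mul_left_cancel₀ hr' (add_left_cancel h)
  rw [← himg]
  refine isAccessiblePoint_image_closedBall (f := fun z : ℂ => c + r * z) (by fun_prop)
    hinj.injOn hu ?_
  rw [himg]
  have hfr : c + r * u ∈ frontier (closedBall c r) := by
    rw [frontier_closedBall c hr.ne', mem_sphere, dist_eq_norm, add_sub_cancel_left, norm_mul,
      Complex.norm_real, Real.norm_of_nonneg hr.le, hu, mul_one]
  rw [frontier_eq_closure_inter_closure] at hfr
  exact hfr.2

theorem IsArcFromTo.isCompact_image {α : ℝ → ℂ} {x y : ℂ} (h : IsArcFromTo α x y) :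
    IsCompact (α '' Icc 0 1) :=
  isCompact_Icc.image_of_continuousOn h.continuousOn

theorem IsArcFromTo.logTrivial {α : ℝ → ℂ} {x y : ℂ} (h : IsArcFromTo α x y) :
    LogTrivial (α '' Icc 0 1) :=
  ((convex_Icc 0 1).logTrivial isCompact_Icc).image isCompact_Icc h.continuousOn h.injOn

theorem IsArcFromTo.forall_mem_image {α : ℝ → ℂ} {x y : ℂ} (h : IsArcFromTo α x y)
    {P : ℂ → Prop} (hx : P x) (hy : P y) (hP : ∀ t ∈ Ioo (0 : ℝ) 1, P (α t)) :
    ∀ z ∈ α '' Icc 0 1, P z := by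
  rintro _ ⟨t, ht, rfl⟩
  rcases ht.1.eq_or_lt with rfl | h0
  · rwa [h.source]
  rcases ht.2.eq_or_lt with rfl | h1
  · rwa [h.target]
  exact hP t ⟨h0, h1⟩

theorem IsArcFromTo.left_mem_image {α : ℝ → ℂ} {x y : ℂ} (h : IsArcFromTo α x y) :
    x ∈ α '' Icc 0 1 := ⟨0, by simp, h.source⟩

theorem IsArcFromTo.right_mem_image {α : ℝ → ℂ} {x y : ℂ} (h : IsArcFromTo α x y) :
    y ∈ α '' Icc 0 1 := ⟨1, by simp, h.target⟩

/-- Accessible boundary points of a central disc can be joined by disjoint arcs to given accessible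
boundary points of finitely many outer discs. -/
theorem exists_disjoint_arcs {ι : Type*} [Fintype ι] {D₀ : Set ℂ} {D : ι → Set ℂ} {c p : ι → ℂ}
    {T : Set ℂ} (hD₀ : IsCompact D₀) (hL₀ : LogTrivial D₀) (hD : ∀ i, IsCompact (D i))
    (hL : ∀ i, LogTrivial (D i)) (hc : ∀ i, IsAccessiblePoint D₀ (c i))
    (hp : ∀ i, IsAccessiblePoint (D i) (p i)) (hcinj : Function.Injective c)
    (hdisj₀ : ∀ i, Disjoint D₀ (D i)) (hdisj : ∀ i j, i ≠ j → Disjoint (D i) (D j))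
    (hT : T.Countable) (S : Finset ι) :
    ∃ α : ι → ℝ → ℂ,
      (∀ i ∈ S, IsArcFromTo (α i) (c i) (p i)) ∧
      (∀ i ∈ S, ∀ t ∈ Ioo (0 : ℝ) 1, α i t ∉ D₀ ∧ (∀ j, α i t ∉ D j) ∧ α i t ∉ T) ∧
      (∀ i ∈ S, ∀ j ∈ S, i ≠ j → Disjoint (α i '' Icc 0 1) (α j '' Icc 0 1)) ∧
      LogTrivial (D₀ ∪ ⋃ i ∈ S, (D i ∪ α i '' Icc 0 1)) := by
  classical
  induction S using Finset.induction_on with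
  | empty => exact ⟨fun _ _ => 0, by simp, by simp, by simp, by simpa using hL₀⟩
  | insert a S ha ih =>
    obtain ⟨α, hα, hαavoid, hαdisj, hαL⟩ := ih
    set M : Set ℂ := ⋃ i ∈ S, (D i ∪ α i '' Icc 0 1) with hM
    set N : Set ℂ := ⋃ i ∈ (insert a S)ᶜ, D i with hN
    have hMcl : IsClosed M := S.finite_toSet.isClosed_biUnion fun i hi =>
      (hD i).isClosed.union (hα i hi).isCompact_image.isClosed
    have hNcl : IsClosed N := (insert a S)ᶜ.finite_toSet.isClosed_biUnion fun i _ =>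
      (hD i).isClosed
    have hcM : ∀ i ∉ S, c i ∉ M := by
      intro i hi hmem
      obtain ⟨j, hj, h | h⟩ := mem_iUnion₂.1 hmem
      · exact (hdisj₀ j).le_bot ⟨(hc i).mem, h⟩
      · refine (hα j hj).forall_mem_image (P := fun z => z ≠ c i) ?_ ?_ ?_ _ h rfl
        · exact fun he => hi (hcinj he ▸ hj)
        · exact fun he => (hdisj₀ j).le_bot ⟨he ▸ (hc i).mem, (hp j).mem⟩
        · exact fun t ht he => (hαavoid j hj t ht).1 (he ▸ (hc i).mem)
    have hDM : ∀ i ∉ S, Disjoint (D₀ ∪ M) (D i) := by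
      intro i hi
      refine disjoint_union_left.2 ⟨hdisj₀ i, ?_⟩
      rw [hM, disjoint_iUnion₂_left]
      intro j hj
      have hji : j ≠ i := fun h => hi (h ▸ hj)
      refine disjoint_union_left.2 ⟨hdisj j i hji, disjoint_left.2 ?_⟩
      refine (hα j hj).forall_mem_image ?_ ?_ fun t ht => (hαavoid j hj t ht).2.1 i
      · exact fun h => (hdisj₀ i).le_bot ⟨(hc j).mem, h⟩
      · exact fun h => (hdisj j i hji).le_bot ⟨(hp j).mem, h⟩
    have hcN : c a ∉ N := by
      intro h
      obtain ⟨j, -, h⟩ := mem_iUnion₂.1 h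
      exact (hdisj₀ j).le_bot ⟨(hc a).mem, h⟩
    have hDN : Disjoint (D a) N := by
      rw [hN, disjoint_iUnion₂_right]
      intro j hj
      refine hdisj a j ?_
      rintro rfl
      simp at hj
    have hKcl : IsClosed (D₀ ∪ (M ∪ (D a ∪ N))) :=
      hD₀.isClosed.union (hMcl.union ((hD a).isClosed.union hNcl))
    have hMcomp : IsCompact M := S.isCompact_biUnion fun i hi =>
      (hD i).union (hα i hi).isCompact_image
    have hNcomp : IsCompact N := (insert a S)ᶜ.isCompact_biUnion fun i _ => hD i
    have hKL : LogTrivial (D₀ ∪ (M ∪ (D a ∪ N))) := by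
      have hNL : LogTrivial N := LogTrivial.biUnion _ D (fun i _ => (hD i).isClosed)
        (fun i _ => hL i) fun i _ j _ hij => hdisj i j hij
      have h1 : LogTrivial (D a ∪ N) := (hL a).union (hD a).isClosed hNcl
        (by rw [hDN.inter_eq]; exact isPreconnected_empty) hNL
      have h2 : Disjoint (D₀ ∪ M) (D a ∪ N) := by
        refine disjoint_union_right.2 ⟨hDM a ha, ?_⟩
        rw [hN, disjoint_iUnion₂_right]
        intro j hj
        exact hDM j fun h => by simp [h] at hj
      rw [← union_assoc]
      exact hαL.union (hD₀.isClosed.union hMcl) ((hD a).isClosed.union hNcl)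
        (by rw [h2.inter_eq]; exact isPreconnected_empty) h1
    have hKc : IsAccessiblePoint (D₀ ∪ (M ∪ (D a ∪ N))) (c a) := by
      refine (hc a).union (hMcl.union ((hD a).isClosed.union hNcl)) ?_
      rintro (h | h | h)
      exacts [hcM a ha h, (hdisj₀ a).le_bot ⟨(hc a).mem, h⟩, hcN h]
    have hpDM : p a ∉ D₀ ∪ M := fun h => (hDM a ha).le_bot ⟨h, (hp a).mem⟩
    have hKp : IsAccessiblePoint (D₀ ∪ (M ∪ (D a ∪ N))) (p a) := by
      have h := (hp a).union (F := D₀ ∪ M ∪ N) ((hD₀.isClosed.union hMcl).union hNcl) (by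
        rintro (h | h)
        exacts [hpDM h, hDN.le_bot ⟨(hp a).mem, h⟩])
      have he : D a ∪ (D₀ ∪ M ∪ N) = D₀ ∪ (M ∪ (D a ∪ N)) := by
        ext z
        simp only [mem_union]
        tauto
      rwa [he] at h
    have hcp : c a ≠ p a := fun h => (hdisj₀ a).le_bot ⟨(hc a).mem, h ▸ (hp a).mem⟩
    obtain ⟨β, hβ, hβavoid⟩ := exists_isArcFromTo_of_uniformlyAccessible hKcl
      (hKL.isPreconnected_compl (hD₀.union (hMcomp.union ((hD a).union hNcomp)))) hT hcp
      hKc.uniformlyAccessible hKc.mem_closure_compl hKp.uniformlyAccessible hKp.mem_closure_compl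
    have hβD : ∀ t ∈ Ioo (0 : ℝ) 1, ∀ j, β t ∉ D j := by
      intro t ht j hj
      refine (hβavoid t ht).1 ?_
      by_cases hjS : j ∈ S
      · exact Or.inr (Or.inl (mem_iUnion₂.2 ⟨j, hjS, Or.inl hj⟩))
      · by_cases hja : j = a
        · exact Or.inr (Or.inr (Or.inl (hja ▸ hj)))
        · exact Or.inr (Or.inr (Or.inr (mem_iUnion₂.2 ⟨j, by simp [hjS, hja], hj⟩)))
    have hβM : Disjoint (β '' Icc 0 1) M := disjoint_left.2 <|
      hβ.forall_mem_image (hcM a ha) (fun h => hpDM (Or.inr h)) fun t ht h =>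
        (hβavoid t ht).1 (Or.inr (Or.inl h))
    have hup : ∀ i ∈ S, Function.update α a β i = α i := fun i hi =>
      Function.update_of_ne (by rintro rfl; exact ha hi) _ _
    have hαM : ∀ i ∈ S, α i '' Icc 0 1 ⊆ M := fun i hi z hz =>
      mem_iUnion₂.2 ⟨i, hi, Or.inr hz⟩
    refine ⟨Function.update α a β, ?_, ?_, ?_, ?_⟩
    · intro i hi
      rcases Finset.mem_insert.1 hi with rfl | hi
      · rwa [Function.update_self]
      · rw [hup i hi]
        exact hα i hi
    · intro i hi
      rcases Finset.mem_insert.1 hi with rfl | hi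
      · rw [Function.update_self]
        exact fun t ht => ⟨fun h => (hβavoid t ht).1 (Or.inl h), hβD t ht, (hβavoid t ht).2⟩
      · rw [hup i hi]
        exact hαavoid i hi
    · intro i hi j hj hij
      rcases Finset.mem_insert.1 hi with hia | hi' <;>
        rcases Finset.mem_insert.1 hj with hja | hj'
      · exact absurd (hia.trans hja.symm) hij
      · rw [hia, Function.update_self, hup j hj']
        exact hβM.mono_right (hαM j hj')
      · rw [hja, Function.update_self, hup i hi']
        exact (hβM.mono_right (hαM i hi')).symm
      · rw [hup i hi', hup j hj']
        exact hαdisj i hi' j hj' hij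
    · have hU : ⋃ i ∈ S, (D i ∪ Function.update α a β i '' Icc 0 1) = M :=
        iUnion₂_congr fun i hi => by rw [hup i hi]
      have he : D₀ ∪ ⋃ i ∈ insert a S, (D i ∪ Function.update α a β i '' Icc 0 1)
          = (D₀ ∪ M) ∪ β '' Icc 0 1 ∪ D a := by
        rw [Finset.set_biUnion_insert, hU, Function.update_self]
        ext z
        simp only [mem_union]
        tauto
      rw [he]
      have hDMcl := hD₀.isClosed.union hMcl
      have hβcl := hβ.isCompact_image.isClosed
      refine LogTrivial.union (hDMcl.union hβcl) (hD a).isClosed ?_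
        (LogTrivial.union hDMcl hβcl ?_ hαL hβ.logTrivial) (hL a)
      · have : ((D₀ ∪ M) ∪ β '' Icc 0 1) ∩ D a = {p a} := by
          refine Subset.antisymm ?_ (singleton_subset_iff.2
            ⟨Or.inr hβ.right_mem_image, (hp a).mem⟩)
          rintro z ⟨hz | hz, hza⟩
          · exact ((hDM a ha).le_bot ⟨hz, hza⟩).elim
          · revert hza
            refine hβ.forall_mem_image (P := fun z => z ∈ D a → z ∈ ({p a} : Set ℂ)) ?_ ?_ ?_ z hz
            · exact fun h => ((hdisj₀ a).le_bot ⟨(hc a).mem, h⟩).elim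
            · exact fun _ => rfl
            · exact fun t ht h => (hβD t ht a h).elim
        rw [this]
        exact isPreconnected_singleton
      · have : (D₀ ∪ M) ∩ β '' Icc 0 1 = {c a} := by
          refine Subset.antisymm ?_ (singleton_subset_iff.2
            ⟨Or.inl (hc a).mem, hβ.left_mem_image⟩)
          rintro z ⟨hz, hzβ⟩
          revert hz
          refine hβ.forall_mem_image (P := fun z => z ∈ D₀ ∪ M → z ∈ ({c a} : Set ℂ)) ?_ ?_ ?_
            z hzβ
          · exact fun _ => rfl
          · exact fun h => (hpDM h).elim
          · exact fun t ht h => ((hβavoid t ht).1 (by rw [← union_assoc]; exact Or.inl h)).elim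
        rw [this]
        exact isPreconnected_singleton

/-! ### Stars in the plane -/

theorem exists_injective_directions (ι : Type*) [Fintype ι] {T : Set ℂ} (hT : T.Countable) :
    ∃ θ : ι → ℂ, Function.Injective θ ∧ (∀ i, ‖θ i‖ = 1) ∧
      ∀ i, ∀ m : ℝ, m ≠ 0 → m * θ i ∉ T := by
  have hX : ((fun z : ℂ => z.re / z.im) '' T).Countable := hT.image _
  obtain ⟨x, hx⟩ : ∃ x : ι ↪ ℝ, ∀ i, x i ∉ (fun z : ℂ => z.re / z.im) '' T := by
    have hinf : ((fun z : ℂ => z.re / z.im) '' T)ᶜ.Infinite := by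
      intro hfin
      exact not_countable_univ (α := ℝ) (by
        rw [← union_compl_self ((fun z : ℂ => z.re / z.im) '' T)]
        exact hX.union hfin.countable)
    refine ⟨((Fintype.equivFin ι).toEmbedding.trans Fin.valEmbedding).trans
      ((hinf.natEmbedding _).trans (Function.Embedding.subtype _)), fun i => ?_⟩
    exact (hinf.natEmbedding _ _).2
  have hne : ∀ i, (x i + Complex.I : ℂ) ≠ 0 := fun i h => by
    have := congrArg Complex.im h
    simp at this
  have hpos : ∀ i, 0 < ‖(x i + Complex.I : ℂ)‖ := fun i => norm_pos_iff.2 (hne i)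
  have hre : ∀ i, ∀ m : ℝ, (m * ((x i + Complex.I) / ‖(x i + Complex.I : ℂ)‖) : ℂ).re
      = m / ‖(x i + Complex.I : ℂ)‖ * x i := fun i m => by
    rw [Complex.re_ofReal_mul, Complex.div_ofReal_re]
    simp
    ring
  have him : ∀ i, ∀ m : ℝ, (m * ((x i + Complex.I) / ‖(x i + Complex.I : ℂ)‖) : ℂ).im
      = m / ‖(x i + Complex.I : ℂ)‖ := fun i m => by
    rw [Complex.im_ofReal_mul, Complex.div_ofReal_im]
    simp
    ring
  have hratio : ∀ i, ∀ m : ℝ, m ≠ 0 →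
      (m * ((x i + Complex.I) / ‖(x i + Complex.I : ℂ)‖) : ℂ).re /
        (m * ((x i + Complex.I) / ‖(x i + Complex.I : ℂ)‖) : ℂ).im = x i := fun i m hm => by
    rw [hre, him]
    exact mul_div_cancel_left₀ _ (div_ne_zero hm (hpos i).ne')
  refine ⟨fun i => (x i + Complex.I) / ‖(x i + Complex.I : ℂ)‖, fun i j hij => ?_, fun i => ?_,
    fun i m hm hmem => hx i ⟨_, hmem, hratio i m hm⟩⟩
  · have h1 := hratio i 1 one_ne_zero
    have h2 := hratio j 1 one_ne_zero
    simp only at hij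
    rw [hij, h2] at h1
    exact x.injective h1.symm
  · rw [norm_div, Complex.norm_real, norm_norm, div_self (hpos i).ne']

/-- Finitely many arcs which start at a common point `c` and are otherwise disjoint, the `i`-th
one meeting the union of the discs only at its endpoint `p i`. -/
theorem exists_plane_star {ι : Type*} [Fintype ι] {D : ι → Set ℂ} {p : ι → ℂ} {T : Set ℂ}
    (hD : ∀ i, IsCompact (D i)) (hL : ∀ i, LogTrivial (D i))
    (hp : ∀ i, IsAccessiblePoint (D i) (p i)) (hdisj : ∀ i j, i ≠ j → Disjoint (D i) (D j))
    (hT : T.Countable) :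
    ∃ (c : ℂ) (β : ι → ℝ → ℂ),
      (∀ i, ContinuousOn (β i) (Icc 0 1)) ∧ (∀ i, β i 0 = c) ∧ (∀ i, β i 1 = p i) ∧
      (∀ i j, ∀ s ∈ Icc (0 : ℝ) 1, ∀ t ∈ Icc (0 : ℝ) 1, β i s = β j t → s = t ∧ (s = 0 ∨ i = j)) ∧
      ∀ i, ∀ t ∈ Ico (0 : ℝ) 1, (∀ j, β i t ∉ D j) ∧ β i t ∉ T := by
  have hU : IsCompact (⋃ i, D i) := isCompact_iUnion hD
  obtain ⟨c, hcD, hcT⟩ := (hT.dense_compl ℝ).inter_open_nonempty _ hU.isClosed.isOpen_compl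
    (nonempty_compl.2 hU.ne_univ)
  obtain ⟨r, hr, hball⟩ := nhds_basis_closedBall.mem_iff.1 (hU.isClosed.isOpen_compl.mem_nhds hcD)
  have hballD : ∀ j, ∀ z ∈ closedBall c r, z ∉ D j := fun j z hz hzD =>
    hball hz (mem_iUnion.2 ⟨j, hzD⟩)
  obtain ⟨θ, hθinj, hθ, hθT⟩ := exists_injective_directions ι (hT.image fun z => z - c)
  have hr' : (r : ℂ) ≠ 0 := by exact_mod_cast hr.ne'
  obtain ⟨α, hα, hαavoid, hαdisj, -⟩ := exists_disjoint_arcs (isCompact_closedBall c r)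
    ((convex_closedBall c r).logTrivial (isCompact_closedBall c r)) hD hL
    (fun i => isAccessiblePoint_closedBall c hr (hθ i)) hp
    (fun i j h => hθinj (mul_left_cancel₀ hr' (add_left_cancel h)))
    (fun j => disjoint_left.2 (hballD j)) hdisj hT Finset.univ
  simp only [Finset.mem_univ, forall_true_left] at hα hαavoid hαdisj
  have hnear : ∀ i, ∀ t : ℝ, 0 ≤ t → ‖((2 * t * r : ℝ) : ℂ) * θ i‖ = 2 * t * r := fun i t ht => by
    rw [norm_mul, hθ, mul_one, Complex.norm_real, Real.norm_of_nonneg (by positivity)]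
  have hnear_mem : ∀ i, ∀ t : ℝ, 0 ≤ t → t ≤ 1 / 2 →
      c + ((2 * t * r : ℝ) : ℂ) * θ i ∈ closedBall c r := fun i t ht ht' => by
    rw [mem_closedBall, dist_eq_norm, add_sub_cancel_left, hnear i t ht]
    nlinarith
  have hfar : ∀ i, ∀ t : ℝ, 1 / 2 < t → t ≤ 1 → α i (2 * t - 1) ∉ closedBall c r := by
    intro i t ht ht'
    rcases ht'.eq_or_lt with rfl | ht'
    · have h1 : (2 * 1 - 1 : ℝ) = 1 := by norm_num
      rw [h1, (hα i).target]
      exact fun h => hballD i _ h (hp i).mem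
    · exact (hαavoid i (2 * t - 1) ⟨by linarith, by linarith⟩).1
  refine ⟨c, fun i t => if t ≤ 1 / 2 then c + ((2 * t * r : ℝ) : ℂ) * θ i else α i (2 * t - 1),
    fun i => ?_, fun i => ?_, fun i => ?_, fun i j s hs t ht hst => ?_, fun i t ht => ?_⟩
  · refine ContinuousOn.if ?_ (by fun_prop) ?_
    · rintro t ⟨-, ht⟩
      rw [show {a : ℝ | a ≤ 1 / 2} = Iic (1 / 2) from rfl, frontier_Iic] at ht
      rw [ht]
      have h0 : (2 * (1 / 2) - 1 : ℝ) = 0 := by norm_num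
      rw [h0, (hα i).source]
      norm_num
    · refine (hα i).continuousOn.comp (by fun_prop) ?_
      rintro t ⟨ht, ht'⟩
      rw [show {a : ℝ | ¬ a ≤ 1 / 2} = Ioi (1 / 2) by ext; simp, closure_Ioi] at ht'
      have := mem_Ici.1 ht'
      exact ⟨by linarith, by linarith [ht.2]⟩
  · simp
  · have h1 : (2 * 1 - 1 : ℝ) = 1 := by norm_num
    simp only [h1, (hα i).target]
    norm_num
  · simp only at hst
    split_ifs at hst with h1 h2 h2
    · have he := add_left_cancel hst
      have hn := congrArg norm he
      rw [hnear i s hs.1, hnear j t ht.1] at hn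
      have hsteq : s = t := by
        have := mul_right_cancel₀ hr.ne' hn
        linarith
      refine ⟨hsteq, or_iff_not_imp_left.2 fun hs0 => hθinj ?_⟩
      rw [← hsteq] at he
      refine mul_left_cancel₀ ?_ he
      exact_mod_cast mul_ne_zero (mul_ne_zero two_ne_zero hs0) hr.ne'
    · exact (hfar j t (not_le.1 h2) ht.2 (hst ▸ hnear_mem i s hs.1 h1)).elim
    · exact (hfar i s (not_le.1 h1) hs.2 (hst ▸ hnear_mem j t ht.1 h2)).elim
    · have hs' : 2 * s - 1 ∈ Icc (0 : ℝ) 1 := ⟨by linarith, by linarith [hs.2]⟩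
      have ht' : 2 * t - 1 ∈ Icc (0 : ℝ) 1 := ⟨by linarith, by linarith [ht.2]⟩
      have hij : i = j := by
        by_contra hij
        exact disjoint_left.1 (hαdisj i j hij) ⟨_, hs', rfl⟩ ⟨_, ht', hst.symm⟩
      subst hij
      have := (hα i).injOn hs' ht' hst
      exact ⟨by linarith, Or.inr rfl⟩
  · simp only
    split_ifs with h
    · refine ⟨fun j => hballD j _ (hnear_mem i t ht.1 h), fun hmem => ?_⟩
      rcases ht.1.eq_or_lt with rfl | h0
      · exact hcT (by simpa using hmem)
      · exact hθT i (2 * t * r) (by positivity) ⟨_, hmem, add_sub_cancel_left _ _⟩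
    · exact (hαavoid i (2 * t - 1) ⟨by linarith, by linarith [ht.2]⟩).2

/-! ### Stars in the sphere -/

/-- A family of paths with a common starting point induces a map on the star spanned by
distinct unit vectors. -/
theorem exists_extension_star {ι X E : Type*} [NormedAddCommGroup E] [NormedSpace ℝ E]
    {e : ι → E} (he : ∀ i, ‖e i‖ = 1) (hinj : Function.Injective e) {c : X} {β : ι → ℝ → X}
    (hβ : ∀ i, β i 0 = c) : ∃ h : E → X, ∀ i, ∀ t, 0 ≤ t → h (t • e i) = β i t := by
  classical
  refine ⟨fun x => if hx : x ≠ 0 ∧ ∃ i, x = ‖x‖ • e i then β hx.2.choose ‖x‖ else c,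
    fun i t ht => ?_⟩
  have hnorm : ‖t • e i‖ = t := by rw [norm_smul, he, mul_one, Real.norm_of_nonneg ht]
  rcases ht.eq_or_lt with rfl | h0
  · simp [hβ]
  · have hx : t • e i ≠ 0 ∧ ∃ j, t • e i = ‖t • e i‖ • e j :=
      ⟨norm_pos_iff.1 (by rwa [hnorm]), i, by rw [hnorm]⟩
    have huniq : ∀ j, t • e i = ‖t • e i‖ • e j → j = i := fun j hj => by
      rw [hnorm] at hj
      exact (hinj (smul_right_injective E h0.ne' hj)).symm
    beta_reduce
    rw [dif_pos hx, huniq _ hx.2.choose_spec, hnorm]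

theorem norm_starVertex (k j : ℕ) : ‖starVertex k j‖ = 1 := by
  simp [starVertex, pt2, EuclideanSpace.norm_eq]

theorem starVertex_succ_injective (k : ℕ) :
    Function.Injective fun i : Fin k => starVertex k ((i : ℕ) + 1) := by
  intro i j hij
  have hk : (k : ℝ) ≠ 0 := by exact_mod_cast (i.pos).ne'
  have h0 := congrArg (fun x : EuclideanSpace ℝ (Fin 2) => x 0) hij
  have h1 := congrArg (fun x : EuclideanSpace ℝ (Fin 2) => x 1) hij
  simp only [starVertex, pt2, WithLp.equiv_symm_apply, Matrix.cons_val_zero,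
    Matrix.cons_val_one] at h0 h1
  obtain ⟨n, hn⟩ := Real.Angle.angle_eq_iff_two_pi_dvd_sub.1 (Real.Angle.cos_sin_inj h0 h1)
  have hn' : (2 * Real.pi) * ((i : ℝ) - j) = (2 * Real.pi) * (n * k) := by
    field_simp at hn
    push_cast at hn
    linear_combination (2 * Real.pi) * hn
  have hij' : ((i : ℕ) : ℤ) - (j : ℕ) = n * k := by
    exact_mod_cast mul_left_cancel₀ (mul_ne_zero two_ne_zero Real.pi_ne_zero) hn'
  have hi := i.isLt
  have hj := j.isLt
  have hn0 : n = 0 := by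
    have h1 : n < 1 := by
      by_contra! h
      nlinarith
    have h2 : -1 < n := by
      by_contra! h
      nlinarith
    omega
  rw [hn0] at hij'
  exact Fin.ext (by omega)

theorem starSet_eq_iUnion (k : ℕ) : starSet k =
    ⋃ i : Fin k, (fun t : ℝ => t • starVertex k ((i : ℕ) + 1)) '' Icc 0 1 := by
  ext x
  simp only [starSet, mem_iUnion, Finset.mem_Icc, exists_prop, segment_eq_image', zero_add,
    sub_zero]
  constructor
  · rintro ⟨j, ⟨hj, hjk⟩, hx⟩
    refine ⟨⟨j - 1, by omega⟩, ?_⟩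
    rwa [show (j - 1) + 1 = j by omega]
  · rintro ⟨i, hx⟩
    exact ⟨i + 1, ⟨by omega, i.isLt⟩, hx⟩

theorem isCompact_starSet (k : ℕ) : IsCompact (starSet k) := by
  rw [starSet_eq_iUnion]
  exact isCompact_iUnion fun i => isCompact_Icc.image (by fun_prop)

/-- Arcs which are disjoint up to a common starting point define an embedding of the star. -/
theorem exists_isEmbedding_starSet {X : Type*} [TopologicalSpace X] [T2Space X] {k : ℕ} {c : X}
    {β : Fin k → ℝ → X} (hβ : ∀ i, ContinuousOn (β i) (Icc 0 1)) (hβ0 : ∀ i, β i 0 = c)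
    (hinj : ∀ i j, ∀ s ∈ Icc (0 : ℝ) 1, ∀ t ∈ Icc (0 : ℝ) 1, β i s = β j t →
      s = t ∧ (s = 0 ∨ i = j)) :
    ∃ h : EuclideanSpace ℝ (Fin 2) → X, Topology.IsEmbedding ((starSet k).domRestrict h) ∧
      (∀ i : Fin k, h (starVertex k ((i : ℕ) + 1)) = β i 1) ∧
      h '' starSet k = ⋃ i, β i '' Icc 0 1 := by
  obtain ⟨h, hh⟩ := exists_extension_star (fun i : Fin k => norm_starVertex k ((i : ℕ) + 1))
    (starVertex_succ_injective k) hβ0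
  have hcont : ContinuousOn h (starSet k) := by
    rw [starSet_eq_iUnion]
    refine (locallyFinite_of_finite _).continuousOn_iUnion
      (fun i => (isCompact_Icc.image (by fun_prop)).isClosed) fun i => ?_
    have hnorm : ∀ t ∈ Icc (0 : ℝ) 1, ‖t • starVertex k ((i : ℕ) + 1)‖ = t := fun t ht => by
      rw [norm_smul, norm_starVertex, mul_one, Real.norm_of_nonneg ht.1]
    refine ((hβ i).comp continuous_norm.continuousOn ?_).congr ?_
    · rintro _ ⟨t, ht, rfl⟩
      simpa only [hnorm t ht] using ht
    · rintro _ ⟨t, ht, rfl⟩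
      simp only [Function.comp_apply, hnorm t ht, hh i t ht.1]
  have hinjOn : InjOn h (starSet k) := by
    rw [starSet_eq_iUnion]
    intro x hx y hy hxy
    obtain ⟨i, s, hs, rfl⟩ := mem_iUnion.1 hx
    obtain ⟨j, t, ht, rfl⟩ := mem_iUnion.1 hy
    simp only [hh i s hs.1, hh j t ht.1] at hxy
    obtain ⟨rfl, rfl | rfl⟩ := hinj i j s hs t ht hxy
    · simp
    · rfl
  have : CompactSpace (starSet k) := isCompact_iff_compactSpace.1 (isCompact_starSet k)
  refine ⟨h, (hcont.domRestrict.isClosedEmbedding hinjOn.injective).isEmbedding, fun i => ?_, ?_⟩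
  · rw [← hh i 1 zero_le_one, one_smul]
  · rw [starSet_eq_iUnion, image_iUnion]
    refine iUnion_congr fun i => ?_
    rw [image_image]
    exact image_congr fun t ht => hh i t ht.1

theorem IsJordanRegion.isCompact {D : Set Sphere2} (h : IsJordanRegion D) : IsCompact D := by
  obtain ⟨f, hf, rfl, -⟩ := h
  exact (isCompact_closedBall _ _).image_of_continuousOn
    (continuousOn_iff_continuous_domRestrict.2 hf.continuous)

/-- The image of a Jordan region in a planar chart of the sphere has no essential logarithms, and
its frontier consists of accessible points. -/
theorem IsJordanRegion.image_chart {D : Set Sphere2} (h : IsJordanRegion D)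
    (φ : OpenPartialHomeomorph Sphere2 ℂ) (hD : D ⊆ φ.source) :
    LogTrivial (φ '' D) ∧ ∀ p ∈ frontier D, IsAccessiblePoint (φ '' D) (φ p) := by
  obtain ⟨f, hf, rfl, hfr⟩ := h
  have hfcont := continuousOn_iff_continuous_domRestrict.2 hf.continuous
  have hmaps : MapsTo f (closedBall 0 1) φ.source := fun x hx => hD (mem_image_of_mem f hx)
  have hg : ContinuousOn (φ ∘ f) (closedBall 0 1) := φ.continuousOn.comp hfcont hmaps
  have hginj : InjOn (φ ∘ f) (closedBall 0 1) :=
    φ.injOn.comp (injOn_iff_injective.2 hf.injective) hmaps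
  rw [← image_comp]
  refine ⟨((convex_closedBall 0 1).logTrivial (isCompact_closedBall 0 1)).image
    (isCompact_closedBall 0 1) hg hginj, fun p hp => ?_⟩
  have hcl : p ∈ closure (f '' closedBall 0 1)ᶜ := by
    rw [frontier_eq_closure_inter_closure] at hp
    exact hp.2
  rw [← hfr] at hp
  obtain ⟨w, hw, rfl⟩ := hp
  have hwB := sphere_subset_closedBall hw
  refine isAccessiblePoint_image_closedBall hg hginj (by simpa using hw) ?_
  have hmem := φ.open_source.inter_closure ⟨hmaps hwB, hcl⟩
  refine closure_mono ?_ ((φ.continuousAt (hmaps hwB)).continuousWithinAt.mem_closure_image hmem)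
  rintro _ ⟨x, ⟨hx, hxD⟩, rfl⟩ ⟨y, hy, hyx⟩
  exact hxD ⟨y, hy, φ.injOn (hmaps hy) hx hyx⟩

theorem exists_chart_compl_singleton (v : Sphere2) :
    ∃ φ : OpenPartialHomeomorph Sphere2 ℂ, φ.source = {v}ᶜ ∧ φ.target = univ := by
  have : Fact (Module.finrank ℝ (EuclideanSpace ℝ (Fin 3)) = 2 + 1) := ⟨by simp⟩
  refine ⟨(stereographic' 2 v).transHomeomorph
    Complex.orthonormalBasisOneI.repr.symm.toHomeomorph, ?_, ?_⟩
  · simp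
  · simp

theorem iUnion_ne_univ_of_pairwise_disjoint {ι X : Type*} [Finite ι] [TopologicalSpace X]
    {D : ι → Set X} (hD : ∀ i, IsClosed (D i)) (hdisj : ∀ i j, i ≠ j → Disjoint (D i) (D j))
    {i : ι} (hi : (frontier (D i)).Nonempty) : ⋃ j, D j ≠ univ := by
  intro h
  have hopen : IsOpen (D i) := by
    have : D i = (⋃ j ∈ {j | j ≠ i}, D j)ᶜ := by
      refine Subset.antisymm (fun x hx hmem => ?_) fun x hx => ?_
      · obtain ⟨j, hj, hxj⟩ := mem_iUnion₂.1 hmem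
        exact disjoint_left.1 (hdisj j i hj) hxj hx
      · obtain ⟨j, hj⟩ := mem_iUnion.1 (h ▸ mem_univ x)
        by_contra hxi
        exact hx (mem_iUnion₂.2 ⟨j, fun hji => hxi (hji ▸ hj), hj⟩)
    rw [this]
    exact ((toFinite _).isClosed_biUnion fun j _ => hD j).isOpen_compl
  rw [IsClopen.frontier_eq ⟨hD i, hopen⟩] at hi
  exact not_nonempty_empty hi

theorem stmt1 (k : ℕ) (hk : 1 ≤ k) (D : Fin k → Set Sphere2)
    (hJordan : ∀ i, IsJordanRegion (D i))
    (hdisj : ∀ i j, i ≠ j → Disjoint (D i) (D j))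
    (Q : Set Sphere2) (hQ : Q = (⋃ i, interior (D i))ᶜ)
    (p : Fin k → Sphere2) (hp : ∀ i, p i ∈ frontier (D i))
    (T : Set Sphere2) (hTQ : T ⊆ Q \ ⋃ i, frontier (D i)) (hT : T.Countable) :
    ∃ h : EuclideanSpace ℝ (Fin 2) → Sphere2,
      Topology.IsEmbedding ((starSet k).restrict h) ∧
      h '' starSet k ⊆ Q ∧
      (∀ i : Fin k, h (starVertex k ((i : ℕ) + 1)) = p i) ∧
      Disjoint (h '' starSet k) T ∧
      h '' starSet k ∩ (⋃ i, frontier (D i)) = Set.range p := by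
  have hcl : ∀ i, IsClosed (D i) := fun i => (hJordan i).isCompact.isClosed
  have hfrD : ∀ i, frontier (D i) ⊆ D i := fun i => (hcl i).frontier_subset
  obtain ⟨v, hv⟩ := (ne_univ_iff_exists_notMem _).1
    (iUnion_ne_univ_of_pairwise_disjoint hcl hdisj ⟨p ⟨0, hk⟩, hp _⟩)
  obtain ⟨φ, hφs, hφt⟩ := exists_chart_compl_singleton v
  have hDs : ∀ i, D i ⊆ φ.source := fun i x hx => by
    rw [hφs]
    rintro rfl
    exact hv (mem_iUnion.2 ⟨i, hx⟩)
  obtain ⟨c, β, hβ, hβ0, hβ1, hβinj, hβavoid⟩ := exists_plane_star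
    (fun i => (hJordan i).isCompact.image_of_continuousOn (φ.continuousOn.mono (hDs i)))
    (fun i => ((hJordan i).image_chart φ (hDs i)).1)
    (fun i => ((hJordan i).image_chart φ (hDs i)).2 (p i) (hp i))
    (fun i j hij => disjoint_image_image fun x hx y hy hxy =>
      disjoint_left.1 (hdisj i j hij) hx (φ.injOn (hDs i hx) (hDs j hy) hxy ▸ hy))
    (hT.image φ)
  have hsymm : ∀ z, φ (φ.symm z) = z := fun z => φ.right_inv (hφt ▸ mem_univ z)
  have hsymm1 : ∀ i, φ.symm (β i 1) = p i := fun i => by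
    rw [hβ1, φ.left_inv (hDs i (hfrD i (hp i)))]
  have havoid : ∀ i, ∀ t ∈ Ico (0 : ℝ) 1,
      (∀ j, φ.symm (β i t) ∉ D j) ∧ φ.symm (β i t) ∉ T := fun i t ht =>
    ⟨fun j hj => (hβavoid i t ht).1 j ⟨_, hj, hsymm _⟩,
      fun hmem => (hβavoid i t ht).2 ⟨_, hmem, hsymm _⟩⟩
  obtain ⟨h, hemb, hend, himg⟩ := exists_isEmbedding_starSet (β := fun i t => φ.symm (β i t))
    (fun i => φ.continuousOn_symm.comp (hβ i) fun t _ => hφt ▸ mem_univ _)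
    (fun i => congrArg φ.symm (hβ0 i))
    (fun i j s hs t ht hst => hβinj i j s hs t ht (by rw [← hsymm (β i s), hst, hsymm]))
  have hcases : ∀ x ∈ h '' starSet k, (∃ i, x = p i) ∨ (∀ j, x ∉ D j) ∧ x ∉ T := by
    intro x hx
    rw [himg] at hx
    obtain ⟨i, t, ht, rfl⟩ := mem_iUnion.1 hx
    rcases ht.2.eq_or_lt with rfl | h1
    · exact Or.inl ⟨i, hsymm1 i⟩
    · exact Or.inr (havoid i t ⟨ht.1, h1⟩)
  refine ⟨h, hemb, ?_, fun i => (hend i).trans (hsymm1 i), ?_, Subset.antisymm ?_ ?_⟩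
  · intro x hx
    rw [hQ]
    intro hmem
    obtain ⟨j, hj⟩ := mem_iUnion.1 hmem
    rcases hcases x hx with ⟨i, rfl⟩ | ⟨hxD, -⟩
    · by_cases hij : i = j
      · subst hij
        exact (hp i).2 hj
      · exact disjoint_left.1 (hdisj i j hij) (hfrD i (hp i)) (interior_subset hj)
    · exact hxD j (interior_subset hj)
  · refine disjoint_left.2 fun x hx hxT => ?_
    rcases hcases x hx with ⟨i, rfl⟩ | ⟨-, hxT'⟩
    · exact (hTQ hxT).2 (mem_iUnion.2 ⟨i, hp i⟩)
    · exact hxT' hxT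
  · rintro x ⟨hx, hxfr⟩
    rcases hcases x hx with ⟨i, rfl⟩ | ⟨hxD, -⟩
    · exact mem_range_self i
    · obtain ⟨j, hj⟩ := mem_iUnion.1 hxfr
      exact (hxD j (hfrD j hj)).elim
  · rintro _ ⟨i, rfl⟩
    refine ⟨?_, mem_iUnion.2 ⟨i, hp i⟩⟩
    rw [himg]
    exact mem_iUnion.2 ⟨i, 1, right_mem_Icc.2 zero_le_one, hsymm1 i⟩
end

section
/- Let n ≥ 1 and let M be a compact topological n-manifold with boundary, with manifold interior Int M and manifold boundary ∂M = M \ Int M. Let A be a topological space and let f : A → M be a topological embedding whose range has empty interior in M, and let T be a countable subset of Int M. Then there exists a topological embedding g : A → M whose range is disjoint from T, such that f⁻¹(∂M) = g⁻¹(∂M) and g(a) = f(a) for every a ∈ A with f(a) ∈ ∂M. -/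
open Metric Set

/-- The closed half-space `Hⁿ = {x ∈ ℝⁿ : x₀ ≥ 0}` (for `0 < n`). -/
def halfSpace (n : ℕ) (hn : 0 < n) : Set (EuclideanSpace ℝ (Fin n)) :=
  {x | 0 ≤ x ⟨0, hn⟩}

/-- In a Banach space, any point of an open ball can be reached from the centre by a homeomorphism
supported in the ball. -/
theorem exists_homeomorph_center_eq {E : Type*} [NormedAddCommGroup E] [NormedSpace ℝ E]
    [CompleteSpace E] {c q : E} {r : ℝ} (hq : q ∈ ball c r) :
    ∃ h : E ≃ₜ E, h c = q ∧ ∀ x ∉ closedBall c r, h x = x := by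
  have hr : 0 < r := pos_of_mem_ball hq
  set b : E → ℝ := fun x => max 0 (1 - dist x c / r) with hb
  set F : E → E := fun x => x + b x • (q - c) with hF
  have hbl : ∀ x y, |b x - b y| ≤ ‖x - y‖ / r := by
    intro x y
    calc |b x - b y| ≤ |(1 - dist x c / r) - (1 - dist y c / r)| := by
          simpa only [hb, max_comm (0 : ℝ)] using abs_max_sub_max_le_abs _ _ (0 : ℝ)
      _ = |dist x c - dist y c| / r := by
          rw [← abs_of_pos hr, ← abs_div, abs_of_pos hr, ← abs_neg]
          congr 1
          ring
      _ ≤ ‖x - y‖ / r := by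
          gcongr
          rw [← dist_eq_norm]
          exact abs_dist_sub_le x y c
  have happ : ApproximatesLinearOn F ((ContinuousLinearEquiv.refl ℝ E : E ≃L[ℝ] E) : E →L[ℝ] E)
      univ (Real.toNNReal (‖q - c‖ / r)) := by
    intro x _ y _
    have : F x - F y - (ContinuousLinearEquiv.refl ℝ E : E →L[ℝ] E) (x - y)
        = (b x - b y) • (q - c) := by
      simp only [hF, ContinuousLinearEquiv.coe_refl, ContinuousLinearMap.coe_id', id_eq, sub_smul]
      abel
    rw [this, norm_smul, Real.coe_toNNReal _ (by positivity), Real.norm_eq_abs]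
    calc |b x - b y| * ‖q - c‖ ≤ ‖x - y‖ / r * ‖q - c‖ := by gcongr; exact hbl x y
      _ = ‖q - c‖ / r * ‖x - y‖ := by ring
  have hc : Subsingleton E ∨ Real.toNNReal (‖q - c‖ / r) <
      ‖((ContinuousLinearEquiv.refl ℝ E).symm : E →L[ℝ] E)‖₊⁻¹ := by
    rcases subsingleton_or_nontrivial E with h | h
    · exact Or.inl h
    · right
      have : ‖((ContinuousLinearEquiv.refl ℝ E).symm : E →L[ℝ] E)‖₊ = 1 := by
        ext
        simp
      rw [this, inv_one, Real.toNNReal_lt_one, div_lt_one hr, ← dist_eq_norm]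
      exact hq
  refine ⟨happ.toHomeomorph F hc, ?_, ?_⟩
  · change F c = q
    simp [hF, hb]
  · intro x hx
    change F x = x
    have hx' : 1 < dist x c / r := by
      rw [one_lt_div hr]
      simpa using hx
    have : b x = 0 := max_eq_left (by linarith)
    simp [hF, this]

/-- A homeomorphism of the model space supported in a compact subset of the target of a chart
extends by the identity to a homeomorphism of the whole space. -/
theorem OpenPartialHomeomorph.exists_homeomorph_extend_id {X E : Type*} [TopologicalSpace X]
    [T2Space X] [TopologicalSpace E] (e : OpenPartialHomeomorph X E) {K : Set E}
    (hK : IsCompact K) (hKt : K ⊆ e.target) (h : E ≃ₜ E) (hid : ∀ x ∉ K, h x = x) :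
    ∃ φ : X ≃ₜ X, (∀ x ∈ e.source, φ x = e.symm (h (e x))) ∧
      ∀ x ∉ e.symm '' K, φ x = x := by
  classical
  let F : (E ≃ₜ E) → X → X := fun h x => if x ∈ e.source then e.symm (h (e x)) else x
  have hKc : IsClosed (e.symm '' K) :=
    (hK.image_of_continuousOn (e.continuousOn_symm.mono hKt)).isClosed
  have hmaps : ∀ h : E ≃ₜ E, (∀ x ∉ K, h x = x) → ∀ y ∈ e.target, h y ∈ e.target := by
    intro h hid y hy
    by_cases hyK : h y ∈ K
    · exact hKt hyK
    · rwa [h.injective (hid _ hyK)]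
  have hoff : ∀ h : E ≃ₜ E, (∀ x ∉ K, h x = x) → ∀ x ∉ e.symm '' K, F h x = x := by
    intro h hid x hx
    by_cases hxs : x ∈ e.source
    · have : e x ∉ K := fun hk => hx ⟨e x, hk, e.left_inv hxs⟩
      simp [F, hxs, hid _ this]
    · simp [F, hxs]
  have hcont : ∀ h : E ≃ₜ E, (∀ x ∉ K, h x = x) → Continuous (F h) := by
    intro h hid
    rw [continuous_iff_continuousAt]
    intro x
    by_cases hxs : x ∈ e.source
    · have h1 : ContinuousAt (fun x => e.symm (h (e x))) x :=
        ContinuousAt.comp (f := fun x => h (e x))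
          (e.continuousAt_symm (hmaps h hid _ (e.map_source hxs)))
          (h.continuous.continuousAt.comp (e.continuousAt hxs))
      refine h1.congr ?_
      filter_upwards [e.open_source.mem_nhds hxs] with y hy
      simp [F, hy]
    · have hx : x ∈ (e.symm '' K)ᶜ := by
        rintro ⟨y, hy, rfl⟩
        exact hxs (e.map_target (hKt hy))
      refine continuousAt_id.congr ?_
      filter_upwards [hKc.isOpen_compl.mem_nhds hx] with y hy
      exact (hoff h hid y hy).symm
  have hinv : ∀ h : E ≃ₜ E, (∀ x ∉ K, h x = x) → ∀ x, F h.symm (F h x) = x := by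
    intro h hid x
    by_cases hxs : x ∈ e.source
    · have ht := hmaps h hid _ (e.map_source hxs)
      simp [F, hxs, e.map_target ht, e.right_inv ht]
    · simp [F, hxs]
  have hid' : ∀ x ∉ K, h.symm x = x := fun x hx => by
    rw [h.symm_apply_eq, hid x hx]
  exact ⟨{  toFun := F h
            invFun := F h.symm
            left_inv := hinv h hid
            right_inv := hinv h.symm hid'
            continuous_toFun := hcont h hid
            continuous_invFun := hcont h.symm hid' },
    fun x hx => if_pos hx, hoff h hid⟩

/-- Inside any neighbourhood of a locally Euclidean point there is a homeomorphism supported in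
that neighbourhood moving the point into a prescribed dense set. -/
theorem OpenPartialHomeomorph.exists_homeomorph_apply_mem_dense {X E : Type*} [TopologicalSpace X]
    [T2Space X] [NormedAddCommGroup E] [NormedSpace ℝ E] [ProperSpace E]
    (e : OpenPartialHomeomorph X E) {p : X} (hp : p ∈ e.source) {D : Set X} (hD : Dense D)
    {O : Set X} (hO : IsOpen O) (hpO : p ∈ O) :
    ∃ φ : X ≃ₜ X, φ p ∈ D ∧ ∀ x ∉ O, φ x = x := by
  have hW : IsOpen (e.target ∩ e.symm ⁻¹' O) := e.isOpen_inter_preimage_symm hO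
  have hpW : e p ∈ e.target ∩ e.symm ⁻¹' O :=
    ⟨e.map_source hp, by simpa [e.left_inv hp] using hpO⟩
  obtain ⟨r, hr, hrW⟩ := nhds_basis_closedBall.mem_iff.1 (hW.mem_nhds hpW)
  obtain ⟨d, hdB, hdD⟩ := hD.inter_open_nonempty _
    (e.isOpen_inter_preimage (isOpen_ball (x := e p) (ε := r))) ⟨p, hp, mem_ball_self hr⟩
  obtain ⟨h, hhc, hhid⟩ := exists_homeomorph_center_eq hdB.2
  obtain ⟨φ, hφ, hφid⟩ := e.exists_homeomorph_extend_id (isCompact_closedBall (e p) r)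
    (fun x hx => (hrW hx).1) h hhid
  refine ⟨φ, ?_, fun x hx => hφid x ?_⟩
  · rwa [hφ p hp, hhc, e.left_inv hdB.1]
  · rintro ⟨y, hy, rfl⟩
    exact hx (hrW hy).2

/-- A homeomorphism between open subsets yields an open partial homeomorphism around each point. -/
theorem exists_openPartialHomeomorph_of_homeomorph_subtype {X E : Type*} [TopologicalSpace X]
    [TopologicalSpace E] {U : Set X} {V : Set E} (hU : IsOpen U) (hV : IsOpen V) (φ : U ≃ₜ V)
    {p : X} (hp : p ∈ U) :
    ∃ e : OpenPartialHomeomorph X E, e.source = U := by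
  have : Nonempty U := ⟨⟨p, hp⟩⟩
  have : Nonempty V := ⟨φ ⟨p, hp⟩⟩
  have h1 := hU.isOpenEmbedding_subtypeVal
  have h2 := hV.isOpenEmbedding_subtypeVal.comp φ.isOpenEmbedding
  refine ⟨h1.toOpenPartialHomeomorph.symm.trans h2.toOpenPartialHomeomorph, ?_⟩
  simp

/-- A sequence of homeomorphisms of a complete metric space that is, together with the sequence of
inverses, fast Cauchy in the uniform metric converges to a homeomorphism. -/
theorem exists_homeomorph_tendsto {X : Type*} [MetricSpace X] [CompleteSpace X]
    (k : ℕ → X ≃ₜ X) (h1 : ∀ n x, dist (k n x) (k (n + 1) x) ≤ 1 / 2 / 2 ^ n)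
    (h2 : ∀ n x, dist ((k n).symm x) ((k (n + 1)).symm x) ≤ 1 / 2 / 2 ^ n) :
    ∃ φ : X ≃ₜ X, ∀ x, Filter.Tendsto (fun n => k n x) Filter.atTop (nhds (φ x)) := by
  have key : ∀ u : ℕ → X → X, (∀ n x, dist (u n x) (u (n + 1) x) ≤ 1 / 2 / 2 ^ n) →
      (∀ n, Continuous (u n)) →
      ∃ v : X → X, Continuous v ∧ TendstoUniformly u v Filter.atTop := by
    intro u hu huc
    choose v hv using fun x => cauchySeq_tendsto_of_complete
      (cauchySeq_of_le_geometric_two (C := 1) (fun n => hu n x))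
    have huv : TendstoUniformly u v Filter.atTop := by
      rw [Metric.tendstoUniformly_iff]
      intro ε hε
      have hlim : Filter.Tendsto (fun n : ℕ => (1 : ℝ) / 2 ^ n) Filter.atTop (nhds 0) := by
        simpa using tendsto_pow_atTop_nhds_zero_of_lt_one (r := (1 / 2 : ℝ))
          (by norm_num) (by norm_num)
      filter_upwards [hlim.eventually_lt_const hε] with n hn x
      rw [dist_comm]
      exact (dist_le_of_le_geometric_two_of_tendsto (fun n => hu n x) (hv x) n).trans_lt hn
    exact ⟨v, huv.continuous (Filter.Frequently.of_forall huc), huv⟩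
  obtain ⟨v, hvc, hv⟩ := key (fun n => k n) h1 (fun n => (k n).continuous)
  obtain ⟨w, hwc, hw⟩ := key (fun n => (k n).symm) h2 (fun n => (k n).symm.continuous)
  refine ⟨{ toFun := v
            invFun := w
            left_inv := fun x => ?_
            right_inv := fun x => ?_
            continuous_toFun := hvc
            continuous_invFun := hwc }, fun x => hv.tendsto_at x⟩
  · refine tendsto_nhds_unique (hw.tendsto_comp hwc.continuousAt (hv.tendsto_at x)) ?_
    simp
  · refine tendsto_nhds_unique (hv.tendsto_comp hvc.continuousAt (hw.tendsto_at x)) ?_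
    simp

theorem Homeomorph.apply_mem_iff_of_fixed_compl {X : Type*} [TopologicalSpace X] {S : Set X}
    (k : X ≃ₜ X) (hk : ∀ x ∉ S, k x = x) (x : X) : k x ∈ S ↔ x ∈ S := by
  refine ⟨fun h => ?_, fun h => ?_⟩
  · by_contra hx
    exact hx (hk x hx ▸ h)
  · by_contra hx
    exact hx ((k.injective (hk _ hx)).symm ▸ h)

/-- A homeomorphism fixing the complement of a locally Euclidean open set `S` can be perturbed by
an arbitrarily small amount, without changing finitely many values that lie in a dense set `D`, so
as to send a given point of `S` into `D`. -/
theorem Homeomorph.exists_perturbation {X E : Type*} [MetricSpace X] [CompactSpace X]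
    [NormedAddCommGroup E] [NormedSpace ℝ E] [ProperSpace E] {S D : Set X} (hS : IsOpen S)
    (hE : ∀ p ∈ S, ∃ e : OpenPartialHomeomorph X E, p ∈ e.source) (hD : Dense D)
    (k : X ≃ₜ X) (hk : ∀ x ∉ S, k x = x) {F : Set X} (hF : F.Finite) {t : X} (ht : t ∈ S)
    {ε : ℝ} (hε : 0 < ε) :
    ∃ k' : X ≃ₜ X, (∀ x ∉ S, k' x = x) ∧ k' t ∈ D ∧ (∀ x ∈ F, k x ∈ D → k' x = k x) ∧
      (∀ x, dist (k x) (k' x) ≤ ε) ∧ ∀ x, dist (k.symm x) (k'.symm x) ≤ ε := by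
  by_cases hkt : k t ∈ D
  · exact ⟨k, hk, hkt, fun _ _ _ => rfl, fun x => by simpa using hε.le,
      fun x => by simpa using hε.le⟩
  obtain ⟨δ, hδ, hδk⟩ := Metric.uniformContinuous_iff.1
    (CompactSpace.uniformContinuous_of_continuous k.symm.continuous) ε hε
  have hktS : k t ∈ S := (k.apply_mem_iff_of_fixed_compl hk t).2 ht
  obtain ⟨e, he⟩ := hE _ hktS
  set η := min ε δ with hη
  have hη0 : 0 < η := lt_min hε hδ
  set G : Set X := k '' F ∩ D with hG
  have hGc : IsClosed G := ((hF.image k).inter_of_left D).isClosed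
  obtain ⟨φ, hφD, hφ⟩ := e.exists_homeomorph_apply_mem_dense he hD
    (O := (ball (k t) (η / 2) ∩ S) ∩ Gᶜ)
    ((isOpen_ball.inter hS).inter hGc.isOpen_compl)
    ⟨⟨mem_ball_self (half_pos hη0), hktS⟩, fun h => hkt h.2⟩
  have hdist : ∀ x, dist x (φ x) < η := by
    intro x
    by_cases hx : x ∈ (ball (k t) (η / 2) ∩ S) ∩ Gᶜ
    · have hx' := (φ.apply_mem_iff_of_fixed_compl hφ x).2 hx
      have a1 := mem_ball.1 hx.1.1
      have a2 := mem_ball.1 hx'.1.1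
      linarith [dist_triangle_right x (φ x) (k t)]
    · rw [hφ x hx, dist_self]
      exact hη0
  refine ⟨k.trans φ, fun x hx => ?_, hφD, fun x hxF hxD => ?_, fun x => ?_, fun x => ?_⟩
  · simp only [Homeomorph.trans_apply, hk x hx]
    exact hφ x fun h => hx h.1.2
  · exact hφ _ fun h => h.2 ⟨⟨x, hxF, rfl⟩, hxD⟩
  · exact (hdist _).le.trans (min_le_left _ _)
  · refine (hδk ?_).le
    have := hdist (φ.symm x)
    rw [φ.apply_symm_apply, dist_comm] at this
    exact this.trans_le (min_le_right _ _)

/-- In a compact metric space, a countable subset of a locally Euclidean open set `S` can be moved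
into any given dense set by a homeomorphism fixing the complement of `S`. -/
theorem exists_homeomorph_mapsTo_dense {X E : Type*} [MetricSpace X] [CompactSpace X]
    [NormedAddCommGroup E] [NormedSpace ℝ E] [ProperSpace E] {S D : Set X} (hS : IsOpen S)
    (hE : ∀ p ∈ S, ∃ e : OpenPartialHomeomorph X E, p ∈ e.source) (hD : Dense D)
    {T : Set X} (hT : T.Countable) (hTS : T ⊆ S) :
    ∃ k : X ≃ₜ X, (∀ x ∉ S, k x = x) ∧ MapsTo k T D := by
  rcases T.eq_empty_or_nonempty with rfl | hne
  · exact ⟨Homeomorph.refl X, fun _ _ => rfl, mapsTo_empty _ _⟩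
  obtain ⟨t, rfl⟩ := hT.exists_eq_range hne
  have step : ∀ (n : ℕ) (k : {k : X ≃ₜ X // ∀ x ∉ S, k x = x}),
      ∃ k' : {k : X ≃ₜ X // ∀ x ∉ S, k x = x}, k'.1 (t n) ∈ D ∧
        (∀ j < n, k.1 (t j) ∈ D → k'.1 (t j) = k.1 (t j)) ∧
        (∀ x, dist (k.1 x) (k'.1 x) ≤ 1 / 2 / 2 ^ n) ∧
        ∀ x, dist (k.1.symm x) (k'.1.symm x) ≤ 1 / 2 / 2 ^ n := by
    rintro n ⟨k, hk⟩
    obtain ⟨k', h1, h2, h3, h4, h5⟩ := k.exists_perturbation hS hE hD hk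
      ((finite_Iio n).image t) (hTS (mem_range_self n)) (ε := 1 / 2 / 2 ^ n) (by positivity)
    exact ⟨⟨k', h1⟩, h2, fun j hj => h3 _ ⟨j, hj, rfl⟩, h4, h5⟩
  choose next hnD hnfix hnd hnd' using step
  let k : ℕ → {k : X ≃ₜ X // ∀ x ∉ S, k x = x} :=
    fun n => Nat.rec ⟨Homeomorph.refl X, fun _ _ => rfl⟩ next n
  obtain ⟨φ, hφ⟩ := exists_homeomorph_tendsto (fun n => (k n).1)
    (fun n => hnd n (k n)) (fun n => hnd' n (k n))
  refine ⟨φ, fun x hx => ?_, ?_⟩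
  · exact tendsto_nhds_unique (hφ x)
      (tendsto_const_nhds.congr fun n => ((k n).2 x hx).symm)
  · rintro _ ⟨n, rfl⟩
    have hD' : (k (n + 1)).1 (t n) ∈ D := hnD n (k n)
    have hstable : ∀ m ≥ n + 1, (k m).1 (t n) = (k (n + 1)).1 (t n) := by
      intro m hm
      induction m, hm using Nat.le_induction with
      | base => rfl
      | succ m hm ih => exact (hnfix m (k m) n hm (ih ▸ hD')).trans ih
    have : φ (t n) = (k (n + 1)).1 (t n) := by
      refine tendsto_nhds_unique (hφ (t n)) (tendsto_const_nhds.congr' ?_)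
      filter_upwards [Filter.eventually_ge_atTop (n + 1)] with m hm
      exact (hstable m hm).symm
    rwa [this]

theorem stmt3 (n : ℕ) (hn : 0 < n)
    (M : Type*) [TopologicalSpace M] [CompactSpace M]
    [TopologicalSpace.MetrizableSpace M]
    -- `M` is an `n`-manifold with boundary: every point has an open neighborhood
    -- homeomorphic to an open subset of the half-space `Hⁿ`.
    (hchart : ∀ m : M, ∃ U : Set M, IsOpen U ∧ m ∈ U ∧
      ∃ V : Set (EuclideanSpace ℝ (Fin n)), V ⊆ halfSpace n hn ∧
        (∃ W : Set (EuclideanSpace ℝ (Fin n)), IsOpen W ∧ V = W ∩ halfSpace n hn) ∧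
        Nonempty (↥U ≃ₜ ↥V))
    -- the manifold interior: points with a neighborhood homeomorphic to an
    -- open subset of `ℝⁿ`
    (Mint : Set M)
    (hMint : Mint = {m : M | ∃ U : Set M, IsOpen U ∧ m ∈ U ∧
      ∃ V : Set (EuclideanSpace ℝ (Fin n)), IsOpen V ∧ Nonempty (↥U ≃ₜ ↥V)})
    -- the manifold boundary `∂M = M \ Int M`
    (Mbd : Set M) (hMbd : Mbd = Set.univ \ Mint)
    (A : Type*) [TopologicalSpace A]
    (f : A → M) (hf : Topology.IsEmbedding f)
    (hint : interior (Set.range f) = ∅)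
    (T : Set M) (hT : T.Countable) (hTint : T ⊆ Mint) :
    ∃ g : A → M,
      Topology.IsEmbedding g ∧
      Disjoint (Set.range g) T ∧
      f ⁻¹' Mbd = g ⁻¹' Mbd ∧
      ∀ a : A, f a ∈ Mbd → g a = f a := by
  let _ : MetricSpace M := TopologicalSpace.metrizableSpaceMetric M
  have hopen : IsOpen Mint := by
    rw [isOpen_iff_forall_mem_open]
    intro m hm
    rw [hMint] at hm
    obtain ⟨U, hU, hmU, V, hV, e⟩ := hm
    exact ⟨U, fun x hx => hMint ▸ ⟨U, hU, hx, V, hV, e⟩, hU, hmU⟩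
  have hcharts : ∀ p ∈ Mint,
      ∃ e : OpenPartialHomeomorph M (EuclideanSpace ℝ (Fin n)), p ∈ e.source := by
    intro p hp
    rw [hMint] at hp
    obtain ⟨U, hU, hpU, V, hV, ⟨e⟩⟩ := hp
    obtain ⟨e', he'⟩ := exists_openPartialHomeomorph_of_homeomorph_subtype hU hV e hpU
    exact ⟨e', he' ▸ hpU⟩
  obtain ⟨k, hk, hkT⟩ := exists_homeomorph_mapsTo_dense hopen hcharts
    (interior_eq_empty_iff_dense_compl.1 hint) hT hTint
  have hksymm : ∀ x ∉ Mint, k.symm x = x := fun x hx => by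
    rw [k.symm_apply_eq, hk x hx]
  subst hMbd
  refine ⟨k.symm ∘ f, k.symm.isEmbedding.comp hf, ?_, ?_, fun a ha => hksymm _ ha.2⟩
  · rw [disjoint_left]
    rintro _ ⟨a, rfl⟩ ha
    exact hkT ha ⟨a, by simp⟩
  · ext a
    simp [k.symm.apply_mem_iff_of_fixed_compl hksymm]
end
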